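/- arXiv:0910.0548 — 4 statements merged into one kernel-verified Lean document; each statement's English description precedes it below -/
import Mathlib

section
/- If the effectiveness function P₂ is strictly increasing on [0,1], then there exists at most one sequence T=(T_k)∈𝒯 satisfying condition (eqT1) at every pair (x,k) with x>0 and k∈ℕ: if T and S both belong to 𝒯 and both satisfy (eqT1) for all x>0, k≥1, then T_k(x)=S_k(x) for all k≥1, x≥0. -/
open Set

/-- An effectiveness function: continuously differentiable, increasing,
`P 0 = 0`, `P 1 = 1` and `P t < 1` for `t < 1`. -/
def IsEffectiveness (P : ℝ → ℝ) : Prop :=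
  ContinuousOn P (Icc 0 1) ∧ ContDiffOn ℝ 1 P (Icc 0 1) ∧
  MonotoneOn P (Icc 0 1) ∧ P 0 = 0 ∧ P 1 = 1 ∧ ∀ t ∈ Ico (0 : ℝ) 1, P t < 1

/-- The class `𝒯` of sequences `(T_k)_{k ≥ 1}` of functions: continuous on `[0,∞)`,
continuously differentiable on `(0,∞)`, with `0 < T_k x ≤ 1`, `T_k' x < 0` and
`T_{k+1} x < T_k x` for `x > 0`, and `T_k 0 = 1`. -/
def IsClassT (T : ℕ → ℝ → ℝ) : Prop :=
  ∀ k, 1 ≤ k →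
    ContinuousOn (T k) (Ici 0) ∧
    ContDiffOn ℝ 1 (T k) (Ioi 0) ∧
    (∀ x, 0 ≤ x → 0 < T k x ∧ T k x ≤ 1) ∧
    (∀ x, 0 < x → deriv (T k) x < 0) ∧
    (∀ x, 0 < x → T (k + 1) x < T k x) ∧
    T k 0 = 1

/-- Condition (eqT1) at `(x, k)`:
`exp (∫₀ˣ log (1 - P₁ (T k β)) dβ) + ∏_{i=1}^k (1 - P₂ (T i x)) = 1`. -/
def EqT1 (P₁ P₂ : ℝ → ℝ) (T : ℕ → ℝ → ℝ) (x : ℝ) (k : ℕ) : Prop :=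
  Real.exp (∫ β in (0 : ℝ)..x, Real.log (1 - P₁ (T k β))) +
    (∏ i ∈ Finset.Icc 1 k, (1 - P₂ (T i x))) = 1

/-- If `f ≤ g` wherever the primitive of `f` exceeds that of `g`, then the primitive of `f`
never exceeds that of `g`. -/
theorem integral_le_integral_of_forall_lt_imp_le {f g : ℝ → ℝ} {x₀ : ℝ} (hx₀ : 0 ≤ x₀)
    (hf : IntervalIntegrable f MeasureTheory.volume 0 x₀)
    (hg : IntervalIntegrable g MeasureTheory.volume 0 x₀)
    (h : ∀ x ∈ Ioc 0 x₀, (∫ β in (0 : ℝ)..x, g β) < (∫ β in (0 : ℝ)..x, f β) → f x ≤ g x) :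
    (∫ β in (0 : ℝ)..x₀, f β) ≤ ∫ β in (0 : ℝ)..x₀, g β := by
  have hcont : ∀ {u : ℝ → ℝ}, IntervalIntegrable u MeasureTheory.volume 0 x₀ →
      ContinuousOn (fun x => ∫ β in (0 : ℝ)..x, u β) (Icc 0 x₀) := by
    intro u hu
    have := intervalIntegral.continuousOn_primitive_interval' hu left_mem_uIcc
    rwa [uIcc_of_le hx₀] at this
  have hcompact : IsCompact {x ∈ Icc 0 x₀ | (∫ β in (0 : ℝ)..x, f β) ≤ ∫ β in (0 : ℝ)..x, g β} :=
    isCompact_Icc.of_isClosed_subset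
      (isClosed_Icc.isClosed_le (hcont hf) (hcont hg)) (sep_subset _ _)
  obtain ⟨a, ⟨ha, hle⟩, hmax⟩ := hcompact.exists_isGreatest
    ⟨0, left_mem_Icc.2 hx₀, by simp⟩
  have hsub : ∀ {u : ℝ → ℝ}, IntervalIntegrable u MeasureTheory.volume 0 x₀ →
      IntervalIntegrable u MeasureTheory.volume 0 a ∧
        IntervalIntegrable u MeasureTheory.volume a x₀ := by
    intro u hu
    constructor <;> refine hu.mono_set ?_
    · rw [uIcc_of_le ha.1, uIcc_of_le hx₀]; exact Icc_subset_Icc_right ha.2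
    · rw [uIcc_of_le ha.2, uIcc_of_le hx₀]; exact Icc_subset_Icc_left ha.1
  have hmono : (∫ β in a..x₀, f β) ≤ ∫ β in a..x₀, g β := by
    refine intervalIntegral.integral_mono_on_of_le_Ioo ha.2 (hsub hf).2 (hsub hg).2 ?_
    intro x hx
    have hx0 : 0 < x := ha.1.trans_lt hx.1
    refine h x ⟨hx0, hx.2.le⟩ ?_
    by_contra! hcon
    exact (hmax ⟨⟨hx0.le, hx.2.le⟩, hcon⟩).not_gt hx.1
  rw [← intervalIntegral.integral_add_adjacent_intervals (hsub hf).1 (hsub hf).2,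
    ← intervalIntegral.integral_add_adjacent_intervals (hsub hg).1 (hsub hg).2]
  exact add_le_add hle hmono

theorem IsClassT.mem_Ico {T : ℕ → ℝ → ℝ} (hT : IsClassT T) {k : ℕ} (hk : 1 ≤ k) {x : ℝ}
    (hx : 0 < x) : T k x ∈ Ico (0 : ℝ) 1 := by
  obtain ⟨hc, -, hpos, hderiv, -, h0⟩ := hT k hk
  refine ⟨(hpos x hx.le).1.le, ?_⟩
  have hanti : StrictAntiOn (T k) (Ici 0) :=
    strictAntiOn_of_deriv_neg (convex_Ici 0) hc (by simpa using hderiv)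
  simpa [h0] using hanti self_mem_Ici hx.le hx

theorem IsClassT.prod_pos {P : ℝ → ℝ} (hP : IsEffectiveness P) {T : ℕ → ℝ → ℝ}
    (hT : IsClassT T) (k : ℕ) {x : ℝ} (hx : 0 < x) :
    0 < ∏ i ∈ Finset.Icc 1 k, (1 - P (T i x)) :=
  Finset.prod_pos fun _ hi =>
    sub_pos.2 (hP.2.2.2.2.2 _ (hT.mem_Ico (Finset.mem_Icc.1 hi).1 hx))

/-- A solution of (eqT1) has an integrable integrand: otherwise the exponential would be `1`. -/
theorem EqT1.intervalIntegrable {P₁ P₂ : ℝ → ℝ} {T : ℕ → ℝ → ℝ} {x : ℝ} {k : ℕ}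
    (h : EqT1 P₁ P₂ T x k) (hP₂ : IsEffectiveness P₂) (hT : IsClassT T) (hx : 0 < x) :
    IntervalIntegrable (fun β => Real.log (1 - P₁ (T k β))) MeasureTheory.volume 0 x := by
  by_contra hint
  have hpos := hT.prod_pos hP₂ k hx
  rw [EqT1, intervalIntegral.integral_undef hint, Real.exp_zero] at h
  linarith

/-- Two solutions with the same first `k` terms have comparable integrals at index `k + 1`. -/
theorem integral_log_le_of_eqT1 {P₁ P₂ : ℝ → ℝ} (hP₁ : IsEffectiveness P₁)
    (hP₂ : IsEffectiveness P₂) {T S : ℕ → ℝ → ℝ} (hT : IsClassT T) (hS : IsClassT S) {k : ℕ}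
    (hTeq : ∀ x > (0 : ℝ), EqT1 P₁ P₂ T x (k + 1))
    (hSeq : ∀ x > (0 : ℝ), EqT1 P₁ P₂ S x (k + 1))
    (heq : ∀ x > (0 : ℝ), ∀ i ∈ Finset.Icc 1 k, T i x = S i x) {x : ℝ} (hx : 0 < x) :
    (∫ β in (0 : ℝ)..x, Real.log (1 - P₁ (T (k + 1) β))) ≤
      ∫ β in (0 : ℝ)..x, Real.log (1 - P₁ (S (k + 1) β)) := by
  refine integral_le_integral_of_forall_lt_imp_le hx.le ((hTeq x hx).intervalIntegrable hP₂ hT hx)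
    ((hSeq x hx).intervalIntegrable hP₂ hS hx) ?_
  intro y hy hlt
  have hTy := hT.mem_Ico (Nat.le_add_left 1 k) hy.1
  have hSy := hS.mem_Ico (Nat.le_add_left 1 k) hy.1
  have hST : S (k + 1) y ≤ T (k + 1) y := by
    by_contra! hcon
    have hP := hP₂.2.2.1 (Ico_subset_Icc_self hTy) (Ico_subset_Icc_self hSy) hcon.le
    have hTE := hTeq y hy.1
    have hSE := hSeq y hy.1
    have hexp := Real.exp_lt_exp.2 hlt
    rw [EqT1, Finset.prod_Icc_succ_top (Nat.le_add_left 1 k)] at hTE hSE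
    rw [Finset.prod_congr rfl fun i hi => by rw [heq y hy.1 i hi]] at hTE
    have hmul := mul_le_mul_of_nonneg_left (sub_le_sub_left hP 1) (hS.prod_pos hP₂ k hy.1).le
    linarith
  have hP := hP₁.2.2.1 (Ico_subset_Icc_self hSy) (Ico_subset_Icc_self hTy) hST
  exact Real.log_le_log (sub_pos.2 (hP₁.2.2.2.2.2 _ hTy)) (by linarith)

/-- Corollary 1. If the effectiveness function `P₂` is strictly
increasing on `[0,1]`, there is at most one sequence `T ∈ 𝒯` satisfying (eqT1) at
every pair `(x,k)` with `x > 0`, `k ≥ 1`: if `T` and `S` both belong to `𝒯` and both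
satisfy (eqT1), then `T_k x = S_k x` for all `k ≥ 1`, `x ≥ 0`. -/
theorem eqT1_unique_of_strictMono
    (P₁ P₂ : ℝ → ℝ) (hP₁ : IsEffectiveness P₁) (hP₂ : IsEffectiveness P₂)
    (hP₂strict : StrictMonoOn P₂ (Icc 0 1))
    (T S : ℕ → ℝ → ℝ) (hT : IsClassT T) (hS : IsClassT S)
    (hTeq : ∀ x > (0 : ℝ), ∀ k, 1 ≤ k → EqT1 P₁ P₂ T x k)
    (hSeq : ∀ x > (0 : ℝ), ∀ k, 1 ≤ k → EqT1 P₁ P₂ S x k) :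
    ∀ k, 1 ≤ k → ∀ x, (0 : ℝ) ≤ x → T k x = S k x := by
  intro k
  induction k using Nat.strong_induction_on with
  | _ n ih =>
  intro hn x hx
  obtain ⟨k, rfl⟩ : ∃ k, n = k + 1 := ⟨n - 1, by omega⟩
  have heq : ∀ x > (0 : ℝ), ∀ i ∈ Finset.Icc 1 k, T i x = S i x := fun x hx i hi =>
    ih i (Nat.lt_succ_of_le (Finset.mem_Icc.1 hi).2) (Finset.mem_Icc.1 hi).1 x (le_of_lt hx)
  rcases hx.eq_or_lt with rfl | hx
  · rw [(hT _ hn).2.2.2.2.2, (hS _ hn).2.2.2.2.2]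
  have hint := le_antisymm
    (integral_log_le_of_eqT1 hP₁ hP₂ hT hS (fun x hx => hTeq x hx _ hn)
      (fun x hx => hSeq x hx _ hn) heq hx)
    (integral_log_le_of_eqT1 hP₁ hP₂ hS hT (fun x hx => hSeq x hx _ hn)
      (fun x hx => hTeq x hx _ hn) (fun x hx i hi => (heq x hx i hi).symm) hx)
  have hTE := hTeq x hx _ hn
  have hSE := hSeq x hx _ hn
  rw [EqT1, Finset.prod_Icc_succ_top hn] at hTE hSE
  rw [Finset.prod_congr rfl fun i hi => by rw [heq x hx i hi], hint] at hTE
  have hfactor := mul_left_cancel₀ (hS.prod_pos hP₂ k hx).ne'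
    (add_left_cancel (hTE.trans hSE.symm))
  exact hP₂strict.injOn (Ico_subset_Icc_self (hT.mem_Ico hn hx))
    (Ico_subset_Icc_self (hS.mem_Ico hn hx)) (sub_right_injective hfactor)
end

section
/- Suppose T=(T_k)∈𝒯 satisfies, for all x>0 and k≥1, the relation exp(∫₀ˣ log p(T_k(β)) dβ) + ∏_{i=1}^k q(T_i(x)) = 1. Then T satisfies the system (difeq) of ordinary differential equations: for all x>0 and k≥1, T_k'(x) = −[(1−∏_{i=1}^k q(T_i(x)))·log p(T_k(x)) − q(T_k(x))·(1−∏_{i=1}^{k−1} q(T_i(x)))·log p(T_{k−1}(x))] / (q'(T_k(x))·∏_{i=1}^{k−1} q(T_i(x))), where for k=1 the empty product equals 1 and the term containing T₀ is absent, so T₁'(x) = −(1−q(T₁(x)))·log p(T₁(x))/q'(T₁(x)). -/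
open Set

/-- The standing hypotheses on `p, q` (with derivatives `p', q'`): `p, q` are
continuous on `[0,1]` and continuously differentiable on `(0,1]`, with
`p 0 = q 0 = 1`, `p 1 = q 1 = 0`, `p t > 0` for `t < 1`, `p' ≤ 0` and `q' < 0`
on `(0,1]`.  (In the duel `p = 1 - P₁`, `q = 1 - P₂`.) -/
def PQContext (p q p' q' : ℝ → ℝ) : Prop :=
  ContinuousOn p (Icc 0 1) ∧ ContinuousOn q (Icc 0 1) ∧
  (∀ t ∈ Ioc (0 : ℝ) 1, HasDerivWithinAt p (p' t) (Ioc 0 1) t) ∧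
  (∀ t ∈ Ioc (0 : ℝ) 1, HasDerivWithinAt q (q' t) (Ioc 0 1) t) ∧
  ContinuousOn p' (Ioc 0 1) ∧ ContinuousOn q' (Ioc 0 1) ∧
  p 0 = 1 ∧ q 0 = 1 ∧ p 1 = 0 ∧ q 1 = 0 ∧
  (∀ t ∈ Ico (0 : ℝ) 1, 0 < p t) ∧
  (∀ t ∈ Ioc (0 : ℝ) 1, p' t ≤ 0) ∧ (∀ t ∈ Ioc (0 : ℝ) 1, q' t < 0)

/-- The right-hand side `φ_k(T₁(x), …, T_k(x))` of the `k`-th equation of the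
system (difeq):
`-[(1 - ∏_{i=1}^k q(T_i x)) log p(T_k x) - q(T_k x)(1 - ∏_{i=1}^{k-1} q(T_i x)) log p(T_{k-1} x)]`
`/ (q'(T_k x) ∏_{i=1}^{k-1} q(T_i x))`.
For `k = 1` the products over `i ∈ [1,0]` are empty (equal to `1`), so the term
containing `T₀` carries the factor `1 - 1 = 0` and is absent, giving
`T₁' = -(1 - q(T₁)) log p(T₁) / q'(T₁)`. -/
noncomputable def difeqRHS (p q q' : ℝ → ℝ) (T : ℕ → ℝ → ℝ) (k : ℕ) (x : ℝ) : ℝ :=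
  -(((1 - ∏ i ∈ Finset.Icc 1 k, q (T i x)) * Real.log (p (T k x))
      - q (T k x) * (1 - ∏ i ∈ Finset.Icc 1 (k - 1), q (T i x)) *
          Real.log (p (T (k - 1) x)))
    / (q' (T k x) * ∏ i ∈ Finset.Icc 1 (k - 1), q (T i x)))

open Filter Topology MeasureTheory

section ClassT

variable {p q p' q' : ℝ → ℝ} {T : ℕ → ℝ → ℝ}

/-- Members of a sequence in `𝒯` take values in `(0,1)` on `(0,∞)`. -/
lemma IsClassT.mem_Ioo (hT : IsClassT T) {k : ℕ} (hk : 1 ≤ k) {x : ℝ} (hx : 0 < x) :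
    T k x ∈ Ioo (0 : ℝ) 1 := by
  obtain ⟨hcont, -, hbd, hneg, -, h0⟩ := hT k hk
  have hanti : StrictAntiOn (T k) (Ici 0) :=
    strictAntiOn_of_deriv_neg (convex_Ici 0) hcont fun y hy => hneg y (by simpa using hy)
  exact ⟨(hbd x hx.le).1, h0 ▸ hanti self_mem_Ici hx.le hx⟩

lemma IsClassT.hasDerivAt (hT : IsClassT T) {k : ℕ} (hk : 1 ≤ k) {x : ℝ} (hx : 0 < x) :
    HasDerivAt (T k) (deriv (T k) x) x :=
  (((hT k hk).2.1.differentiableOn one_ne_zero).differentiableAt (Ioi_mem_nhds hx)).hasDerivAt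

lemma PQContext.hasDerivAt_q (hpq : PQContext p q p' q') {t : ℝ} (ht : t ∈ Ioo (0 : ℝ) 1) :
    HasDerivAt q (q' t) t := by
  obtain ⟨-, -, -, hq, -⟩ := hpq
  exact (hq t (Ioo_subset_Ioc_self ht)).hasDerivAt (Ioc_mem_nhds ht.1 ht.2)

lemma PQContext.q_pos (hpq : PQContext p q p' q') {t : ℝ} (ht : t ∈ Ioo (0 : ℝ) 1) :
    0 < q t := by
  have hderiv := fun s hs => hpq.hasDerivAt_q (t := s) hs
  obtain ⟨-, hcont, -, -, -, -, -, -, -, hq1, -, -, hneg⟩ := hpq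
  have hanti : StrictAntiOn q (Icc 0 1) :=
    strictAntiOn_of_deriv_neg (convex_Icc 0 1) hcont fun s hs => by
      rw [interior_Icc] at hs
      rw [(hderiv s hs).deriv]
      exact hneg s (Ioo_subset_Ioc_self hs)
  exact hq1 ▸ hanti (Ioo_subset_Icc_self ht) (right_mem_Icc.2 zero_le_one) ht.2

lemma PQContext.continuousAt_log_p (hpq : PQContext p q p' q') (hT : IsClassT T) {k : ℕ}
    (hk : 1 ≤ k) {x : ℝ} (hx : 0 < x) :
    ContinuousAt (fun β => Real.log (p (T k β))) x := by
  have hmem := hT.mem_Ioo hk hx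
  obtain ⟨hp, -, -, -, -, -, -, -, -, -, hpos, -⟩ := hpq
  have hpT : ContinuousAt p (T k x) := hp.continuousAt (Icc_mem_nhds hmem.1 hmem.2)
  exact (hpT.comp (f := T k) (hT.hasDerivAt hk hx).continuousAt).log
    (hpos _ (Ioo_subset_Ico_self hmem)).ne'

lemma PQContext.prod_q_pos (hpq : PQContext p q p' q') (hT : IsClassT T) (k : ℕ) {x : ℝ}
    (hx : 0 < x) : 0 < ∏ i ∈ Finset.Icc 1 k, q (T i x) :=
  Finset.prod_pos fun _ hi => hpq.q_pos (hT.mem_Ioo (Finset.mem_Icc.1 hi).1 hx)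

/-- If the integral relation holds at `x`, then `log p(T_k)` is integrable on `[0,x]`:
otherwise the integral would be `0` and the product would vanish. -/
lemma PQContext.intervalIntegrable_log_p (hpq : PQContext p q p' q') (hT : IsClassT T)
    {k : ℕ} {x : ℝ} (hx : 0 < x)
    (hrel : Real.exp (∫ β in (0 : ℝ)..x, Real.log (p (T k β))) +
      (∏ i ∈ Finset.Icc 1 k, q (T i x)) = 1) :
    IntervalIntegrable (fun β => Real.log (p (T k β))) volume 0 x := by
  by_contra h
  rw [intervalIntegral.integral_undef h, Real.exp_zero] at hrel
  linarith [hpq.prod_q_pos hT k hx]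

/-- The integral relation determines the derivative of `∏_{i=1}^k q(T_i)`. -/
lemma PQContext.hasDerivAt_prod_q (hpq : PQContext p q p' q') (hT : IsClassT T)
    (hrel : ∀ x > (0 : ℝ), ∀ k, 1 ≤ k →
      Real.exp (∫ β in (0 : ℝ)..x, Real.log (p (T k β))) +
        (∏ i ∈ Finset.Icc 1 k, q (T i x)) = 1) (k : ℕ) {x : ℝ} (hx : 0 < x) :
    HasDerivAt (fun y => ∏ i ∈ Finset.Icc 1 k, q (T i y))
      (-((1 - ∏ i ∈ Finset.Icc 1 k, q (T i x)) * Real.log (p (T k x)))) x := by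
  rcases Nat.eq_zero_or_pos k with rfl | hk
  · simpa using hasDerivAt_const x (1 : ℝ)
  have hmeas : StronglyMeasurableAtFilter (fun β => Real.log (p (T k β))) (𝓝 x) volume :=
    ContinuousOn.stronglyMeasurableAtFilter isOpen_Ioi
      (fun y hy => (hpq.continuousAt_log_p hT hk hy).continuousWithinAt) x hx
  have hint := intervalIntegral.integral_hasDerivAt_right
    (hpq.intervalIntegrable_log_p hT hx (hrel x hx k hk)) hmeas
    (hpq.continuousAt_log_p hT hk hx)
  rw [← eq_sub_of_add_eq (hrel x hx k hk)]
  refine (hint.exp.const_sub 1).congr_of_eventuallyEq ?_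
  filter_upwards [Ioi_mem_nhds hx] with y hy
  exact eq_sub_of_add_eq' (hrel y hy k hk)

end ClassT

/-- If `T ∈ 𝒯` satisfies, for all `x > 0` and `k ≥ 1`,
`exp (∫₀ˣ log p (T_k β) dβ) + ∏_{i=1}^k q (T_i x) = 1`, then `T` satisfies the
system (difeq): `T_k' x = difeqRHS p q q' T k x` for all `x > 0`, `k ≥ 1`. -/
theorem difeq_of_integral_relation
    (p q p' q' : ℝ → ℝ) (hpq : PQContext p q p' q')
    (T : ℕ → ℝ → ℝ) (hT : IsClassT T)
    (hrel : ∀ x > (0 : ℝ), ∀ k, 1 ≤ k →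
      Real.exp (∫ β in (0 : ℝ)..x, Real.log (p (T k β))) +
        (∏ i ∈ Finset.Icc 1 k, q (T i x)) = 1) :
    ∀ x > (0 : ℝ), ∀ k, 1 ≤ k → deriv (T k) x = difeqRHS p q q' T k x := by
  intro x hx k hk
  have hmem := hT.mem_Ioo hk hx
  have hsplit (y : ℝ) : ∏ i ∈ Finset.Icc 1 k, q (T i y) =
      (∏ i ∈ Finset.Icc 1 (k - 1), q (T i y)) * q (T k y) := by
    obtain ⟨n, rfl⟩ := Nat.exists_eq_add_of_le' hk
    exact Finset.prod_Icc_succ_top (by omega) _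
  have hmul := (hpq.hasDerivAt_prod_q hT hrel (k - 1) hx).fun_mul
    ((hpq.hasDerivAt_q hmem).comp x (hT.hasDerivAt hk hx))
  have hprod := hpq.hasDerivAt_prod_q hT hrel k hx
  have heq := hprod.unique (hmul.congr_of_eventuallyEq (.of_forall hsplit))
  have hQ := (hpq.prod_q_pos hT (k - 1) hx).ne'
  have hq' : q' (T k x) ≠ 0 := by
    obtain ⟨-, -, -, -, -, -, -, -, -, -, -, -, hneg⟩ := hpq
    exact (hneg _ (Ioo_subset_Ioc_self hmem)).ne
  rw [difeqRHS, ← neg_div, eq_div_iff (mul_ne_zero hq' hQ)]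
  simp only [Function.comp_apply] at heq
  linear_combination -heq
end

section
/- The system (difeq) of ordinary differential equations with initial conditions T_k(0)=1 for all k≥1 has a solution (T_k)_{k≥1} defined on the whole half-line x>0, and this solution belongs to the class 𝒯 (each T_k is continuous on [0,∞), continuously differentiable on (0,∞), satisfies 0<T_k(x)≤1, T_k'(x)<0 and T_{k+1}(x)<T_k(x) for x>0, and T_k(0)=1). -/
open Set

open Filter Topology

/-- Comparison of two differentiable functions on an interval. -/
lemma le_of_hasDerivWithinAt_lt {f f' B B' : ℝ → ℝ} {a b : ℝ}
    (hf : ∀ x ∈ Icc a b, HasDerivWithinAt f (f' x) (Icc a b) x) (ha : f a ≤ B a)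
    (hB : ∀ x ∈ Icc a b, HasDerivWithinAt B (B' x) (Icc a b) x)
    (bound : ∀ x ∈ Icc a b, f x = B x → f' x < B' x) : ∀ x ∈ Icc a b, f x ≤ B x := by
  have right {g g' : ℝ → ℝ} (hg : ∀ x ∈ Icc a b, HasDerivWithinAt g (g' x) (Icc a b) x) :
      ∀ x ∈ Ico a b, HasDerivWithinAt g (g' x) (Ici x) x := fun x hx =>
    (hg x (Ico_subset_Icc_self hx)).mono_of_mem_nhdsWithin
      (mem_of_superset (Icc_mem_nhdsGE hx.2) (Icc_subset_Icc_left hx.1))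
  exact fun x hx => image_le_of_deriv_right_lt_deriv_boundary'
    (fun y hy => (hf y hy).continuousWithinAt) (right hf) ha
    (fun y hy => (hB y hy).continuousWithinAt) (right hB)
    (fun y hy => bound y (Ico_subset_Icc_self hy)) hx

/-- A time-dependent real vector field that is bounded and Lipschitz on the strip
`[a, b] × [c, s]` has a solution on `[a, b]` above any strict subsolution staying in the strip,
provided it points strictly downwards at height `s`. -/
lemma exists_solution_above_subsolution {G : ℝ → ℝ → ℝ} {v v' : ℝ → ℝ} {a b c s K B : ℝ}
    (hab : a ≤ b)
    (hLip : ∀ x ∈ Icc a b, ∀ u ∈ Icc c s, ∀ w ∈ Icc c s, |G x u - G x w| ≤ K * |u - w|)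
    (hcont : ∀ u ∈ Icc c s, ContinuousOn (G · u) (Icc a b))
    (hB : ∀ x ∈ Icc a b, ∀ u ∈ Icc c s, |G x u| ≤ B)
    (hvs : ∀ x ∈ Icc a b, v x ∈ Icc c s)
    (hv : ∀ x ∈ Icc a b, HasDerivWithinAt v (v' x) (Icc a b) x)
    (hsub : ∀ x ∈ Icc a b, v' x < G x (v x))
    (htop : ∀ x ∈ Icc a b, G x s < 0) :
    ∃ α : ℝ → ℝ, α a = v a ∧ ∀ x ∈ Icc a b,
      v x ≤ α x ∧ α x ≤ s ∧ HasDerivWithinAt α (G x (α x)) (Icc a b) x := by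
  have ha : a ∈ Icc a b := left_mem_Icc.2 hab
  have hcs : c ≤ s := (hvs a ha).1.trans (hvs a ha).2
  have hκ (z : ℝ) : max c (min s z) ∈ Icc c s := ⟨le_max_left _ _, max_le hcs (min_le_left _ _)⟩
  have hB0 : 0 ≤ B := (abs_nonneg _).trans (hB a ha c ⟨le_rfl, hcs⟩)
  have hκid {z : ℝ} (hz : z ∈ Icc c s) : max c (min s z) = z := by
    rw [min_eq_right hz.2, max_eq_right hz.1]
  have hPL : IsPicardLindelof (fun x z => G x (max c (min s z))) (⟨a, ha⟩ : Icc a b) (v a)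
      (B * (b - a)).toNNReal 0 B.toNNReal K.toNNReal := by
    refine ⟨fun x hx => ?_, fun z _ => hcont _ (hκ z), fun x hx z _ => ?_, ?_⟩
    · refine LipschitzOnWith.of_dist_le_mul fun y _ z _ => ?_
      rw [Real.dist_eq, Real.dist_eq]
      refine (hLip x hx _ (hκ y) _ (hκ z)).trans ?_
      refine mul_le_mul (Real.le_coe_toNNReal K) ?_ (abs_nonneg _) (NNReal.coe_nonneg _)
      refine (abs_max_sub_max_le_max _ _ _ _).trans (max_le (by simp) ?_)
      exact (abs_min_sub_min_le_max _ _ _ _).trans (max_le (by simp) le_rfl)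
    · rw [Real.norm_eq_abs, Real.coe_toNNReal _ hB0]
      exact hB x hx _ (hκ z)
    · have : 0 ≤ b - a := sub_nonneg.2 hab
      simp [Real.coe_toNNReal _ hB0, this, Real.coe_toNNReal _ (mul_nonneg hB0 this)]
  obtain ⟨α, hα0, hα⟩ := hPL.exists_eq_forall_mem_Icc_hasDerivWithinAt₀
  have hlow : ∀ x ∈ Icc a b, v x ≤ α x := by
    refine le_of_hasDerivWithinAt_lt hv hα0.ge hα fun x hx h => ?_
    rw [← h, hκid (hvs x hx)]
    exact hsub x hx
  have hup : ∀ x ∈ Icc a b, α x ≤ s := by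
    refine le_of_hasDerivWithinAt_lt (B := fun _ => s) (B' := fun _ => 0) hα
      (hα0.le.trans (hvs a ha).2) (fun x _ => hasDerivWithinAt_const _ _ _) fun x hx h => ?_
    rw [h, hκid ⟨hcs, le_rfl⟩]
    exact htop x hx
  refine ⟨α, hα0, fun x hx => ⟨hlow x hx, hup x hx, ?_⟩⟩
  have := hα x hx
  rwa [hκid ⟨(hvs x hx).1.trans (hlow x hx), hup x hx⟩] at this

/-- A nonincreasing function on `(0, 1]`, of class `C¹` on `(0, 1)`, which vanishes at `1` and
blows up at `0`. -/
structure IsRate (L L' : ℝ → ℝ) : Prop where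
  anti : AntitoneOn L (Ioc 0 1)
  cont : ContinuousOn L (Ioc 0 1)
  one : L 1 = 0
  tendsto_atTop : Tendsto L (𝓝[>] 0) atTop
  hasDerivAt : ∀ u ∈ Ioo (0 : ℝ) 1, HasDerivAt L (L' u) u
  cont_deriv : ContinuousOn L' (Ioo 0 1)

lemma IsRate.nonneg {L L' : ℝ → ℝ} (hL : IsRate L L') {u : ℝ} (hu : u ∈ Ioc (0 : ℝ) 1) :
    0 ≤ L u :=
  hL.one ▸ hL.anti hu (right_mem_Ioc.2 zero_lt_one) hu.2

/-- The properties of the last factor `u = q ∘ T_k` and of the full product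
`Y = ∏_{i ≤ k} q ∘ T_i` that are propagated from one equation to the next one. -/
structure IsProfile (L Y u : ℝ → ℝ) : Prop where
  Y_pos : ∀ x, 0 < x → 0 < Y x
  Y_lt : ∀ x, 0 < x → Y x < 1
  u_pos : ∀ x, 0 < x → 0 < u x
  u_lt : ∀ x, 0 < x → u x < 1
  rate_pos : ∀ x, 0 < x → 0 < L (u x)
  hasDerivAt_Y : ∀ x, 0 < x → HasDerivAt Y ((1 - Y x) * L (u x)) x
  hasDerivAt_u : ∀ x, 0 < x →
    ∃ d, HasDerivAt u d x ∧ 0 < d ∧ d ≤ L (u x) * (1 - u x) * (u x / Y x)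
  tendsto_Y : Tendsto Y (𝓝[>] 0) (𝓝 0)
  tendsto_u : Tendsto u (𝓝[>] 0) (𝓝 0)

namespace IsProfile

variable {L L' Y u : ℝ → ℝ}

lemma u_strictMono (h : IsProfile L Y u) : StrictMonoOn u (Ioi 0) := by
  refine strictMonoOn_of_deriv_pos (convex_Ioi 0) (fun x hx => ?_) fun x hx => ?_
  · obtain ⟨d, hd, -⟩ := h.hasDerivAt_u x hx
    exact hd.continuousAt.continuousWithinAt
  · rw [interior_Ioi] at hx
    obtain ⟨d, hd, hpos, -⟩ := h.hasDerivAt_u x hx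
    rwa [hd.deriv]

lemma Y_strictMono (h : IsProfile L Y u) : StrictMonoOn Y (Ioi 0) := by
  refine strictMonoOn_of_deriv_pos (convex_Ioi 0)
    (fun x hx => (h.hasDerivAt_Y x hx).continuousAt.continuousWithinAt) fun x hx => ?_
  rw [interior_Ioi] at hx
  rw [(h.hasDerivAt_Y x hx).deriv]
  exact mul_pos (sub_pos.2 (h.Y_lt x hx)) (h.rate_pos x hx)

lemma mem (h : IsProfile L Y u) {x : ℝ} (hx : 0 < x) : u x ∈ Ioc (0 : ℝ) 1 :=
  ⟨h.u_pos x hx, (h.u_lt x hx).le⟩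

lemma continuousAt_u (h : IsProfile L Y u) {x : ℝ} (hx : 0 < x) : ContinuousAt u x :=
  (h.hasDerivAt_u x hx).choose_spec.1.continuousAt

lemma continuousAt_rate (h : IsProfile L Y u) (hL : IsRate L L') {x : ℝ} (hx : 0 < x) :
    ContinuousAt (fun x => L (u x)) x :=
  ContinuousAt.comp (f := u) (hL.hasDerivAt _ ⟨h.u_pos x hx, h.u_lt x hx⟩).continuousAt
    (h.continuousAt_u hx)

lemma rate_anti (h : IsProfile L Y u) (hL : IsRate L L') :
    AntitoneOn (fun x => L (u x)) (Ioi 0) := fun _ hx _ hy hxy =>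
  hL.anti (h.mem hx) (h.mem hy) (h.u_strictMono.monotoneOn hx hy hxy)

end IsProfile

/-- The right-hand side of the equation satisfied by the factor `w` following `u`. -/
noncomputable def stepField (L Y u : ℝ → ℝ) (x w : ℝ) : ℝ :=
  ((1 - Y x * w) * L w - w * (1 - Y x) * L (u x)) / Y x

/-- Nonnegativity of `stepField` propagates to later times and smaller heights. -/
lemma stepField_nonneg_of_le {L L' Y u : ℝ → ℝ} (hL : IsRate L L') (h : IsProfile L Y u)
    {x₁ x₂ w₁ w₂ : ℝ} (hx₁ : 0 < x₁) (hx : x₁ ≤ x₂) (hw₂ : 0 < w₂) (hw : w₂ ≤ w₁) (hw₁ : w₁ ≤ 1)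
    (hnn : 0 ≤ stepField L Y u x₁ w₁) : 0 ≤ stepField L Y u x₂ w₂ := by
  have hx₂ : 0 < x₂ := hx₁.trans_le hx
  have hY1 := h.Y_pos x₁ hx₁
  have hY2 := h.Y_lt x₂ hx₂
  have hY12 : Y x₁ ≤ Y x₂ := h.Y_strictMono.monotoneOn hx₁ hx₂ hx
  have hY2' := hY1.trans_le hY12
  have hM : L (u x₂) ≤ L (u x₁) := h.rate_anti hL hx₁ hx₂ hx
  have hw₁0 : 0 < w₁ := hw₂.trans_le hw
  have hLw : L w₁ ≤ L w₂ := hL.anti ⟨hw₂, hw.trans hw₁⟩ ⟨hw₁0, hw₁⟩ hw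
  have hL1 := hL.nonneg ⟨hw₁0, hw₁⟩
  unfold stepField at *
  refine div_nonneg ?_ hY2'.le
  have e1 : w₁ * (1 - Y x₁) * L (u x₁) ≤ (1 - Y x₁ * w₁) * L w₁ := by
    by_contra hcon
    exact absurd hnn (not_le.2 (div_neg_of_neg_of_pos (by linarith) hY1))
  have hd1 : 0 < w₁ * (1 - Y x₁) := mul_pos hw₁0 (by linarith)
  have hd2 : 0 < w₂ * (1 - Y x₂) := mul_pos hw₂ (by linarith)
  have e2 : L (u x₁) ≤ (1 - Y x₁ * w₁) / (w₁ * (1 - Y x₁)) * L w₁ := by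
    rw [div_mul_eq_mul_div, le_div_iff₀ hd1]; linarith
  have hρ : (1 - Y x₁ * w₁) / (w₁ * (1 - Y x₁)) ≤ (1 - Y x₂ * w₂) / (w₂ * (1 - Y x₂)) := by
    rw [div_le_div_iff₀ hd1 hd2]
    have h1 : w₂ * (1 - Y x₁ * w₁) ≤ w₁ * (1 - Y x₁ * w₂) := by nlinarith
    have h2 : (1 - Y x₁ * w₂) * (1 - Y x₂) ≤ (1 - Y x₂ * w₂) * (1 - Y x₁) := by
      nlinarith [mul_nonneg (sub_nonneg.2 hY12) (sub_nonneg.2 (hw.trans hw₁))]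
    calc (1 - Y x₁ * w₁) * (w₂ * (1 - Y x₂)) = w₂ * (1 - Y x₁ * w₁) * (1 - Y x₂) := by ring
      _ ≤ w₁ * (1 - Y x₁ * w₂) * (1 - Y x₂) := mul_le_mul_of_nonneg_right h1 (by linarith)
      _ = w₁ * ((1 - Y x₁ * w₂) * (1 - Y x₂)) := by ring
      _ ≤ w₁ * ((1 - Y x₂ * w₂) * (1 - Y x₁)) := mul_le_mul_of_nonneg_left h2 hw₁0.le
      _ = _ := by ring
  have e3 : L (u x₂) ≤ (1 - Y x₂ * w₂) / (w₂ * (1 - Y x₂)) * L w₂ := by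
    refine hM.trans (e2.trans (mul_le_mul hρ hLw hL1 ?_))
    exact div_nonneg (by nlinarith) hd2.le
  rw [div_mul_eq_mul_div, le_div_iff₀ hd2] at e3
  linarith

/-- The previous factor is a strict subsolution of the next equation. -/
lemma lt_stepField_self {L Y u : ℝ → ℝ} (h : IsProfile L Y u) {x d : ℝ} (hx : 0 < x)
    (hd : d ≤ L (u x) * (1 - u x) * (u x / Y x)) : d < stepField L Y u x (u x) := by
  have hY := h.Y_pos x hx
  have h1 := h.u_lt x hx
  have hpos : 0 < L (u x) * (1 - u x) := mul_pos (h.rate_pos x hx) (by linarith)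
  have e : stepField L Y u x (u x) = L (u x) * (1 - u x) * (1 / Y x) := by
    unfold stepField; ring
  rw [e]
  exact hd.trans_lt (mul_lt_mul_of_pos_left (div_lt_div_of_pos_right h1 hY) hpos)

/-- Solutions of the next equation on compact intervals, started on the previous factor. -/
lemma exists_stepField_solution_Icc {L L' Y u : ℝ → ℝ} (hL : IsRate L L') (h : IsProfile L Y u)
    {a b : ℝ} (ha : 0 < a) (hab : a ≤ b) :
    ∃ w : ℝ → ℝ, w a = u a ∧ ∀ x ∈ Icc a b, u x ≤ w x ∧ w x < 1 ∧
      HasDerivWithinAt w (stepField L Y u x (w x)) (Icc a b) x ∧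
      0 ≤ stepField L Y u x (w x) := by
  have hb : 0 < b := ha.trans_le hab
  have hpos : ∀ x ∈ Icc a b, 0 < x := fun x hx => ha.trans_le hx.1
  have hm := h.rate_pos b hb
  have hYb := h.Y_lt b hb
  obtain ⟨s, ⟨hs1, hsu, hs2⟩, hsL⟩ : ∃ s, (s < 1 ∧ u b ≤ s ∧ 1 / 2 ≤ s) ∧
      L s < 1 / 2 * ((1 - Y b) * L (u b)) := by
    have h1 : Tendsto L (𝓝[Ioc 0 1] 1) (𝓝 0) := by
      have := hL.cont 1 (right_mem_Ioc.2 zero_lt_one)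
      rwa [ContinuousWithinAt, hL.one] at this
    have h2 : Tendsto L (𝓝[<] 1) (𝓝 0) := by
      refine h1.mono_left (nhdsWithin_le_of_mem ?_)
      exact mem_of_superset (Ioo_mem_nhdsLT zero_lt_one) Ioo_subset_Ioc_self
    have h3 : ∀ᶠ s in 𝓝[<] (1 : ℝ), L s < 1 / 2 * ((1 - Y b) * L (u b)) :=
      h2.eventually_lt_const (mul_pos one_half_pos (mul_pos (by linarith) hm))
    have h4 : ∀ᶠ s in 𝓝[<] (1 : ℝ), s ∈ Ioo (max (u b) (1 / 2)) 1 :=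
      Ioo_mem_nhdsLT (max_lt (h.u_lt b hb) (by norm_num))
    obtain ⟨s, hs, hs'⟩ := (h3.and h4).exists
    exact ⟨s, ⟨hs'.2, (le_max_left _ _).trans hs'.1.le, (le_max_right _ _).trans hs'.1.le⟩, hs⟩
  have hc := h.u_pos a ha
  have hsub : Icc (u a) s ⊆ Ioo 0 1 := fun w hw => ⟨hc.trans_le hw.1, hw.2.trans_lt hs1⟩
  obtain ⟨K, hK⟩ := isCompact_Icc.exists_bound_of_continuousOn (hL.cont_deriv.mono hsub)
  have hLip : ∀ w₁ ∈ Icc (u a) s, ∀ w₂ ∈ Icc (u a) s, |L w₁ - L w₂| ≤ K * |w₁ - w₂| :=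
    fun w₁ hw₁ w₂ hw₂ => (convex_Icc _ _).norm_image_sub_le_of_norm_hasDerivWithin_le
      (fun w hw => (hL.hasDerivAt w (hsub hw)).hasDerivWithinAt) hK hw₂ hw₁
  have hLle : ∀ w ∈ Icc (u a) s, 0 ≤ L w ∧ L w ≤ L (u a) := fun w hw =>
    ⟨hL.nonneg (Ioo_subset_Ioc_self (hsub hw)),
      hL.anti (h.mem ha) (Ioo_subset_Ioc_self (hsub hw)) hw.1⟩
  have hYx : ∀ x ∈ Icc a b, Y a ≤ Y x ∧ Y x ≤ Y b := fun x hx =>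
    ⟨h.Y_strictMono.monotoneOn ha (hpos x hx) hx.1, h.Y_strictMono.monotoneOn (hpos x hx) hb hx.2⟩
  have hMx : ∀ x ∈ Icc a b, L (u b) ≤ L (u x) ∧ L (u x) ≤ L (u a) := fun x hx =>
    ⟨h.rate_anti hL (hpos x hx) hb hx.2, h.rate_anti hL ha (hpos x hx) hx.1⟩
  have hYa := h.Y_pos a ha
  have hux : ∀ x ∈ Icc a b, u x ∈ Icc (u a) s := fun x hx =>
    ⟨h.u_strictMono.monotoneOn ha (hpos x hx) hx.1,
      (h.u_strictMono.monotoneOn (hpos x hx) hb hx.2).trans hsu⟩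
  have hK0 : 0 ≤ K := (norm_nonneg _).trans (hK (u a) (hux a (left_mem_Icc.2 hab)))
  have hℓ : 0 ≤ L (u a) := (h.rate_pos a ha).le
  choose! v' hv' hv'pos hv'le using h.hasDerivAt_u
  obtain ⟨w, hwa, hw⟩ : ∃ w : ℝ → ℝ, w a = u a ∧ ∀ x ∈ Icc a b, u x ≤ w x ∧ w x ≤ s ∧
      HasDerivWithinAt w (stepField L Y u x (w x)) (Icc a b) x := by
    refine exists_solution_above_subsolution (G := stepField L Y u) (v := u)
      (v' := v') (c := u a) (s := s) (K := (K + (K + L (u a)) + L (u a)) / Y a)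
      (B := (L (u a) + L (u a)) / Y a) hab ?_ ?_ ?_ hux
      (fun x hx => (hv' x (hpos x hx)).hasDerivWithinAt)
      (fun x hx => lt_stepField_self h (hpos x hx) (hv'le x (hpos x hx))) ?_
    · intro x hx w₁ hw₁ w₂ hw₂
      have hY := (hYx x hx).1
      have hY1 := (hYx x hx).2.trans_lt hYb
      have hYp := hYa.trans_le hY
      have hM := hMx x hx
      have hMp := h.rate_pos x (hpos x hx)
      have h1 := hsub hw₁
      have e : stepField L Y u x w₁ - stepField L Y u x w₂ =
          ((L w₁ - L w₂) - (Y x * w₁ * (L w₁ - L w₂) + Y x * L w₂ * (w₁ - w₂))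
            - (1 - Y x) * L (u x) * (w₁ - w₂)) / Y x := by
        unfold stepField; ring
      rw [e, abs_div, abs_of_pos hYp, div_mul_eq_mul_div]
      have hl := hLip w₁ hw₁ w₂ hw₂
      have t1 : |Y x * w₁ * (L w₁ - L w₂)| ≤ K * |w₁ - w₂| := by
        rw [abs_mul, abs_of_pos (mul_pos hYp h1.1)]
        exact (mul_le_of_le_one_left (abs_nonneg _) (by nlinarith [h1.1, h1.2])).trans hl
      have t2 : |Y x * L w₂ * (w₁ - w₂)| ≤ L (u a) * |w₁ - w₂| := by
        rw [abs_mul, abs_of_nonneg (mul_nonneg hYp.le (hLle w₂ hw₂).1)]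
        refine mul_le_mul_of_nonneg_right ?_ (abs_nonneg _)
        nlinarith [(hLle w₂ hw₂).1, (hLle w₂ hw₂).2]
      have t3 : |(1 - Y x) * L (u x) * (w₁ - w₂)| ≤ L (u a) * |w₁ - w₂| := by
        rw [abs_mul, abs_of_nonneg (mul_nonneg (by linarith) hMp.le)]
        refine mul_le_mul_of_nonneg_right ?_ (abs_nonneg _)
        nlinarith [hM.1, hM.2]
      refine div_le_div₀ (by positivity) ?_ hYa hY
      refine (abs_sub _ _).trans ?_
      refine (add_le_add ((abs_sub _ _).trans (add_le_add hl ((abs_add_le _ _).trans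
        (add_le_add t1 t2)))) t3).trans (le_of_eq (by ring))
    · intro w₁ hw₁ x hx
      have hx0 := hpos x hx
      have hYc := (h.hasDerivAt_Y x hx0).continuousAt
      have hMc := h.continuousAt_rate hL hx0
      refine ContinuousAt.continuousWithinAt ?_
      change ContinuousAt (fun x => ((1 - Y x * w₁) * L w₁ - w₁ * (1 - Y x) * L (u x)) / Y x) x
      exact (((continuousAt_const.sub (hYc.mul continuousAt_const)).mul continuousAt_const).sub
        ((continuousAt_const.mul (continuousAt_const.sub hYc)).mul hMc)).div hYc
        (h.Y_pos x hx0).ne'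
    · intro x hx w₁ hw₁
      have hY := (hYx x hx).1
      have hY1 := (hYx x hx).2.trans_lt hYb
      have hYp := hYa.trans_le hY
      have hM := hMx x hx
      have hMp := h.rate_pos x (hpos x hx)
      have h1 := hsub hw₁
      have hl := hLle w₁ hw₁
      unfold stepField
      rw [abs_div, abs_of_pos hYp]
      refine div_le_div₀ (by positivity) ((abs_sub _ _).trans (add_le_add ?_ ?_)) hYa hY
      · have : Y x * w₁ ≤ 1 := by nlinarith [h1.1, h1.2]
        rw [abs_of_nonneg (mul_nonneg (by linarith) hl.1)]
        nlinarith [mul_pos hYp h1.1]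
      · have e0 : 0 ≤ w₁ * (1 - Y x) := mul_nonneg h1.1.le (by linarith)
        have e1 : w₁ * (1 - Y x) ≤ 1 := by nlinarith [h1.1, h1.2]
        rw [abs_of_nonneg (mul_nonneg e0 hMp.le)]
        nlinarith
    · intro x hx
      have hY := (hYx x hx).1
      have hY1 := (hYx x hx).2
      have hYp := hYa.trans_le hY
      have hM := (hMx x hx).1
      have hs0 : 0 < s := by linarith
      have hls := hL.nonneg ⟨hs0, hs1.le⟩
      refine div_neg_of_neg_of_pos (sub_neg.2 ?_) hYp
      calc (1 - Y x * s) * L s ≤ L s := by nlinarith [mul_nonneg (mul_pos hYp hs0).le hls]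
        _ < 1 / 2 * ((1 - Y b) * L (u b)) := hsL
        _ ≤ s * ((1 - Y x) * L (u x)) := by
            refine mul_le_mul hs2 (mul_le_mul (by linarith) hM hm.le (by linarith))
              (mul_nonneg (by linarith) hm.le) hs0.le
        _ = _ := by ring
  have hw1 : ∀ x ∈ Icc a b, 0 < w x ∧ w x < 1 := fun x hx =>
    ⟨(h.u_pos x (hpos x hx)).trans_le (hw x hx).1, (hw x hx).2.1.trans_lt hs1⟩
  refine ⟨w, hwa, fun x hx => ⟨(hw x hx).1, (hw1 x hx).2, (hw x hx).2.2, ?_⟩⟩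
  have hwc : ContinuousOn w (Icc a b) := fun y hy => (hw y hy).2.2.continuousWithinAt
  have hfc : ContinuousOn (fun y => stepField L Y u y (w y)) (Icc a b) := by
    have hYc : ContinuousOn Y (Icc a b) := fun y hy =>
      (h.hasDerivAt_Y y (hpos y hy)).continuousAt.continuousWithinAt
    have hMc : ContinuousOn (fun y => L (u y)) (Icc a b) := fun y hy =>
      (h.continuousAt_rate hL (hpos y hy)).continuousWithinAt
    have hLw : ContinuousOn (fun y => L (w y)) (Icc a b) :=
      hL.cont.comp hwc fun y hy => ⟨(hw1 y hy).1, (hw1 y hy).2.le⟩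
    unfold stepField
    exact ((((continuousOn_const.sub (hYc.mul hwc)).mul hLw).sub
      ((hwc.mul (continuousOn_const.sub hYc)).mul hMc)).div hYc
      fun y hy => (h.Y_pos y (hpos y hy)).ne')
  by_contra! hneg
  have hcl : IsCompact (Icc a x ∩ (fun y => stepField L Y u y (w y)) ⁻¹' Ici 0) :=
    isCompact_Icc.of_isClosed_subset
      ((hfc.mono (Icc_subset_Icc_right hx.2)).preimage_isClosed_of_isClosed isClosed_Icc
        isClosed_Ici) inter_subset_left
  have hane : a ∈ Icc a x ∩ (fun y => stepField L Y u y (w y)) ⁻¹' Ici 0 := by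
    refine ⟨left_mem_Icc.2 hx.1, ?_⟩
    change 0 ≤ stepField L Y u a (w a)
    rw [hwa]
    exact ((hv'pos a ha).trans
      (lt_stepField_self h ha (hv'le a ha))).le
  obtain ⟨y, ⟨hy, hy0⟩, hymax⟩ := hcl.exists_isGreatest ⟨a, hane⟩
  have hyx : Icc y x ⊆ Icc a b := Icc_subset_Icc hy.1 hx.2
  have hanti : AntitoneOn w (Icc y x) := by
    refine antitoneOn_of_hasDerivWithinAt_nonpos (f' := fun z => stepField L Y u z (w z))
      (convex_Icc _ _) (hwc.mono hyx)
      (fun z hz => (hw z (hyx (interior_subset hz))).2.2.mono (interior_subset.trans hyx))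
      fun z hz => ?_
    rw [interior_Icc] at hz
    by_contra! hz0
    exact absurd (hymax ⟨⟨hy.1.trans hz.1.le, hz.2.le⟩, hz0.le⟩) (not_le.2 hz.1)
  have := stepField_nonneg_of_le hL h (ha.trans_le hy.1) hy.2 (hw1 x hx).1
    (hanti (left_mem_Icc.2 hy.2) (right_mem_Icc.2 hy.2) hy.2)
    (hw1 y ⟨hy.1, hy.2.trans hx.2⟩).2.le hy0
  exact absurd hneg (not_lt.2 this)

lemma hasDerivWithinAt_mul_of_stepField {L Y u w : ℝ → ℝ} (h : IsProfile L Y u) {x : ℝ}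
    (hx : 0 < x) {s : Set ℝ} (hw : HasDerivWithinAt w (stepField L Y u x (w x)) s x) :
    HasDerivWithinAt (fun z => Y z * w z) ((1 - Y x * w x) * L (w x)) s x := by
  refine ((h.hasDerivAt_Y x hx).hasDerivWithinAt.mul hw).congr_deriv ?_
  have := (h.Y_pos x hx).ne'
  unfold stepField
  field_simp
  ring

/-- Two solutions of the next equation get closer after multiplication by `Y`. -/
lemma abs_sub_le_of_stepField {L L' Y u w₁ w₂ : ℝ → ℝ} (hL : IsRate L L') (h : IsProfile L Y u)
    {a b : ℝ} (ha : 0 < a) (hw₁ : ∀ x ∈ Icc a b, 0 < w₁ x ∧ w₁ x < 1)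
    (hw₂ : ∀ x ∈ Icc a b, 0 < w₂ x ∧ w₂ x < 1)
    (hd₁ : ∀ x ∈ Icc a b, HasDerivWithinAt w₁ (stepField L Y u x (w₁ x)) (Icc a b) x)
    (hd₂ : ∀ x ∈ Icc a b, HasDerivWithinAt w₂ (stepField L Y u x (w₂ x)) (Icc a b) x) :
    ∀ x ∈ Icc a b, |Y x * w₁ x - Y x * w₂ x| ≤ Y a := by
  intro x hx
  have hpos : ∀ x ∈ Icc a b, 0 < x := fun x hx => ha.trans_le hx.1
  have hd : ∀ z ∈ Icc a b, HasDerivWithinAt (fun z => (Y z * w₁ z - Y z * w₂ z) ^ 2)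
      (2 * (Y z * w₁ z - Y z * w₂ z) *
        ((1 - Y z * w₁ z) * L (w₁ z) - (1 - Y z * w₂ z) * L (w₂ z))) (Icc a b) z := fun z hz => by
    refine (((hasDerivWithinAt_mul_of_stepField h (hpos z hz) (hd₁ z hz)).sub
      (hasDerivWithinAt_mul_of_stepField h (hpos z hz) (hd₂ z hz))).pow 2).congr_deriv ?_
    simp
  have key : ∀ y r t : ℝ, 0 < y → y < 1 → 0 < r → t < 1 → r ≤ t →
      (1 - y * t) * L t ≤ (1 - y * r) * L r := fun y r t hy hy1 hr ht hrt => by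
    have ht0 := hr.trans_le hrt
    have h1 := hL.anti ⟨hr, hrt.trans ht.le⟩ ⟨ht0, ht.le⟩ hrt
    have h2 := hL.nonneg ⟨ht0, ht.le⟩
    exact mul_le_mul (by nlinarith) h1 h2 (by nlinarith)
  have hanti : AntitoneOn (fun z => (Y z * w₁ z - Y z * w₂ z) ^ 2) (Icc a b) := by
    refine antitoneOn_of_hasDerivWithinAt_nonpos (convex_Icc _ _)
      (fun z hz => (hd z hz).continuousWithinAt)
      (fun z hz => (hd z (interior_subset hz)).mono interior_subset) fun z hz => ?_
    replace hz := interior_subset hz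
    have hY := h.Y_pos z (hpos z hz)
    have hY1 := h.Y_lt z (hpos z hz)
    rcases le_total (w₁ z) (w₂ z) with hle | hle
    · have := key _ _ _ hY hY1 (hw₁ z hz).1 (hw₂ z hz).2 hle
      exact mul_nonpos_of_nonpos_of_nonneg (by nlinarith) (by linarith)
    · have := key _ _ _ hY hY1 (hw₂ z hz).1 (hw₁ z hz).2 hle
      exact mul_nonpos_of_nonneg_of_nonpos (by nlinarith) (by linarith)
  have haI : a ∈ Icc a b := left_mem_Icc.2 (hx.1.trans hx.2)
  have hle : |Y x * w₁ x - Y x * w₂ x| ≤ |Y a * w₁ a - Y a * w₂ a| :=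
    sq_le_sq.1 (hanti haI hx hx.1)
  refine hle.trans ?_
  have hYa := h.Y_pos a ha
  have h1 := hw₁ a haI
  have h2 := hw₂ a haI
  rw [← mul_sub, abs_mul, abs_of_pos hYa]
  exact mul_le_of_le_one_right hYa.le (abs_le.2 ⟨by linarith, by linarith⟩)

/-- A solution of the next equation on the half-line. -/
lemma exists_stepField_solution {L L' Y u : ℝ → ℝ} (hL : IsRate L L') (h : IsProfile L Y u) :
    ∃ w : ℝ → ℝ, ∀ x, 0 < x → u x ≤ w x ∧ w x < 1 ∧ 0 < L (w x) ∧
      HasDerivAt w (stepField L Y u x (w x)) x ∧ 0 ≤ stepField L Y u x (w x) := by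
  set a : ℕ → ℝ := fun n => 1 / ((n : ℝ) + 1) with ha_def
  set b : ℕ → ℝ := fun n => (n : ℝ) + 1 with hb_def
  have ha : ∀ n, 0 < a n := fun n => Nat.one_div_pos_of_nat
  have hb1 : ∀ n, 1 ≤ b n := fun n => by simp [hb_def]
  have hab : ∀ n, a n ≤ b n := fun n =>
    le_trans (by rw [ha_def]; exact div_le_one_of_le₀ (hb1 n) (by linarith [hb1 n])) (hb1 n)
  have ha_anti : Antitone a := fun m n hmn => Nat.one_div_le_one_div hmn
  have hb_mono : Monotone b := fun m n hmn => by simp only [hb_def]; gcongr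
  have hsub : ∀ {m n}, m ≤ n → Icc (a m) (b m) ⊆ Icc (a n) (b n) := fun hmn =>
    Icc_subset_Icc (ha_anti hmn) (hb_mono hmn)
  have ha_tend : Tendsto a atTop (𝓝[>] 0) :=
    tendsto_nhdsWithin_iff.2 ⟨tendsto_one_div_add_atTop_nhds_zero_nat, Eventually.of_forall ha⟩
  have hYa : Tendsto (fun n => Y (a n)) atTop (𝓝 0) := h.tendsto_Y.comp ha_tend
  have hb_tend : Tendsto b atTop atTop :=
    tendsto_atTop_add_const_right _ _ tendsto_natCast_atTop_atTop
  have hmem : ∀ x, 0 < x → ∀ᶠ n in atTop, x ∈ Ioo (a n) (b n) := fun x hx => by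
    filter_upwards [(tendsto_nhdsWithin_iff.1 ha_tend).1.eventually_lt_const hx,
      hb_tend.eventually_gt_atTop x] with n h1 h2 using ⟨h1, h2⟩
  choose W hWa hW using fun n => exists_stepField_solution_Icc hL h (ha n) (hab n)
  have hW01 : ∀ n, ∀ x ∈ Icc (a n) (b n), 0 < W n x ∧ W n x < 1 := fun n x hx =>
    ⟨(h.u_pos x ((ha n).trans_le hx.1)).trans_le (hW n x hx).1, (hW n x hx).2.1⟩
  have hclose : ∀ N m n, N ≤ m → N ≤ n → ∀ x ∈ Icc (a N) (b N),
      |Y x * W m x - Y x * W n x| ≤ Y (a N) := fun N m n hm hn =>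
    abs_sub_le_of_stepField hL h (ha N) (fun x hx => hW01 m x (hsub hm hx))
      (fun x hx => hW01 n x (hsub hn hx)) (fun x hx => (hW m x (hsub hm hx)).2.2.1.mono (hsub hm))
      (fun x hx => (hW n x (hsub hn hx)).2.2.1.mono (hsub hn))
  have hlim : ∀ x, 0 < x → ∃ l, Tendsto (fun n => Y x * W n x) atTop (𝓝 l) := fun x hx => by
    refine cauchySeq_tendsto_of_complete (Metric.cauchySeq_iff.2 fun ε hε => ?_)
    obtain ⟨N, hN, hNε⟩ := ((hmem x hx).and (hYa.eventually_lt_const hε)).exists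
    exact ⟨N, fun m hm n hn => (hclose N m n hm hn x (Ioo_subset_Icc_self hN)).trans_lt hNε⟩
  choose! l hl using hlim
  have hunif : ∀ N, TendstoUniformlyOn (fun n x => Y x * W n x) l atTop (Icc (a N) (b N)) := by
    intro N
    rw [Metric.tendstoUniformlyOn_iff]
    intro ε hε
    obtain ⟨N', hN', hNε⟩ := ((eventually_ge_atTop N).and (hYa.eventually_lt_const hε)).exists
    filter_upwards [eventually_ge_atTop N'] with n hn x hx
    have hx' := hsub hN' hx
    refine lt_of_le_of_lt ?_ hNε
    rw [Real.dist_eq]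
    refine le_of_tendsto (((hl x ((ha N).trans_le hx.1)).sub_const _).abs) ?_
    filter_upwards [eventually_ge_atTop N'] with m hm using hclose N' m n hm hn x hx'
  have hlc : ∀ N, ContinuousOn l (Icc (a N) (b N)) := fun N => by
    refine (hunif N).continuousOn (Eventually.frequently ?_)
    filter_upwards [eventually_ge_atTop N] with n hn x hx
    have hx0 := (ha N).trans_le hx.1
    exact ((h.hasDerivAt_Y x hx0).continuousAt.continuousWithinAt).mul
      ((hW n x (hsub hn hx)).2.2.1.continuousWithinAt.mono (hsub hn))
  set w : ℝ → ℝ := fun x => l x / Y x with hw_def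
  have hYw : ∀ x, 0 < x → Y x * w x = l x := fun x hx => by
    rw [hw_def]; exact mul_div_cancel₀ _ (h.Y_pos x hx).ne'
  have hwlim : ∀ x, 0 < x → Tendsto (fun n => W n x) atTop (𝓝 (w x)) := fun x hx => by
    refine ((hl x hx).div_const (Y x)).congr fun n => ?_
    rw [mul_div_cancel_left₀ _ (h.Y_pos x hx).ne']
  have hmem' : ∀ x, 0 < x → ∀ᶠ n in atTop, x ∈ Icc (a n) (b n) := fun x hx =>
    (hmem x hx).mono fun n hn => Ioo_subset_Icc_self hn
  have huw : ∀ x, 0 < x → u x ≤ w x := fun x hx =>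
    ge_of_tendsto (hwlim x hx) ((hmem' x hx).mono fun n hn => (hW n x hn).1)
  have hw1 : ∀ x, 0 < x → w x ∈ Ioc (0 : ℝ) 1 := fun x hx =>
    ⟨(h.u_pos x hx).trans_le (huw x hx),
      le_of_tendsto (hwlim x hx) ((hmem' x hx).mono fun n hn => (hW n x hn).2.1.le)⟩
  have hLlim : ∀ x, 0 < x → Tendsto (fun n => L (W n x)) atTop (𝓝 (L (w x))) := fun x hx =>
    (hL.cont (w x) (hw1 x hx)).tendsto.comp (tendsto_nhdsWithin_iff.2 ⟨hwlim x hx,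
      (hmem' x hx).mono fun n hn => ⟨(hW01 n x hn).1, (hW01 n x hn).2.le⟩⟩)
  have hstep : ∀ x, 0 < x → 0 ≤ stepField L Y u x (w x) := fun x hx => by
    have : Tendsto (fun n => stepField L Y u x (W n x)) atTop (𝓝 (stepField L Y u x (w x))) := by
      unfold stepField
      exact (((tendsto_const_nhds.sub ((hwlim x hx).const_mul _)).mul (hLlim x hx)).sub
        (((hwlim x hx).mul_const _).mul_const _)).div_const _
    exact ge_of_tendsto this ((hmem' x hx).mono fun n hn => (hW n x hn).2.2.2)
  have hrate : ∀ x, 0 < x → 0 < L (w x) := fun x hx => by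
    refine (hL.nonneg (hw1 x hx)).lt_of_ne' fun h0 => ?_
    refine absurd (hstep x hx) (not_le.2 (div_neg_of_neg_of_pos ?_ (h.Y_pos x hx)))
    rw [h0, mul_zero, zero_sub, neg_lt_zero]
    exact mul_pos (mul_pos (hw1 x hx).1 (sub_pos.2 (h.Y_lt x hx))) (h.rate_pos x hx)
  have hwlt : ∀ x, 0 < x → w x < 1 := fun x hx => by
    refine (hw1 x hx).2.lt_of_ne fun h1 => ?_
    have := hrate x hx
    rw [h1, hL.one] at this
    exact lt_irrefl _ this
  have hFc : ∀ N, ContinuousOn (fun x => (1 - l x) * L (w x)) (Icc (a N) (b N)) := fun N => by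
    have hYc : ContinuousOn Y (Icc (a N) (b N)) := fun y hy =>
      (h.hasDerivAt_Y y ((ha N).trans_le hy.1)).continuousAt.continuousWithinAt
    refine (continuousOn_const.sub (hlc N)).mul (hL.cont.comp ((hlc N).div hYc fun y hy =>
      (h.Y_pos y ((ha N).trans_le hy.1)).ne') fun y hy => hw1 y ((ha N).trans_le hy.1))
  have hWI : ∀ N, ∀ x ∈ Icc (a N) (b N),
      ∫ t in (a N)..x, (1 - l t) * L (w t) = l x - l (a N) := by
    intro N x hx
    have hI : Icc (a N) x ⊆ Icc (a N) (b N) := Icc_subset_Icc_right hx.2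
    have hIoc : ∀ {t}, t ∈ uIoc (a N) x → t ∈ Icc (a N) (b N) := fun {t} ht => by
      rw [uIoc_of_le hx.1] at ht
      exact hI (Ioc_subset_Icc_self ht)
    have hcontn : ∀ n, N ≤ n →
        ContinuousOn (fun t => (1 - Y t * W n t) * L (W n t)) (Icc (a N) x) := fun n hn => by
      have hYc : ContinuousOn Y (Icc (a N) x) := fun y hy =>
        (h.hasDerivAt_Y y ((ha N).trans_le hy.1)).continuousAt.continuousWithinAt
      have hWc : ContinuousOn (W n) (Icc (a N) x) := fun y hy =>
        (hW n y (hsub hn (hI hy))).2.2.1.continuousWithinAt.mono (hI.trans (hsub hn))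
      refine (continuousOn_const.sub (hYc.mul hWc)).mul (hL.cont.comp hWc fun y hy => ?_)
      have := hW01 n y (hsub hn (hI hy))
      exact ⟨this.1, this.2.le⟩
    have hlim1 : Tendsto (fun n => ∫ t in (a N)..x, (1 - Y t * W n t) * L (W n t)) atTop
        (𝓝 (∫ t in (a N)..x, (1 - l t) * L (w t))) := by
      refine intervalIntegral.tendsto_integral_filter_of_dominated_convergence
        (fun _ => L (u (a N))) ?_ ?_ intervalIntegrable_const ?_
      · filter_upwards [eventually_ge_atTop N] with n hn
        rw [uIoc_of_le hx.1]
        exact ((hcontn n hn).mono Ioc_subset_Icc_self).aestronglyMeasurable measurableSet_Ioc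
      · filter_upwards [eventually_ge_atTop N] with n hn
        refine Eventually.of_forall fun t ht => ?_
        have ht' := hIoc ht
        have ht0 := (ha N).trans_le ht'.1
        have h01 := hW01 n t (hsub hn ht')
        have hY0 := h.Y_pos t ht0
        have hY1 := h.Y_lt t ht0
        have hL0 := hL.nonneg ⟨h01.1, h01.2.le⟩
        have hL1 : L (W n t) ≤ L (u (a N)) := hL.anti (h.mem (ha N)) ⟨h01.1, h01.2.le⟩
          ((h.u_strictMono.monotoneOn (ha N) ht0 ht'.1).trans (hW n t (hsub hn ht')).1)
        have : Y t * W n t ≤ 1 := by nlinarith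
        rw [Real.norm_eq_abs, abs_of_nonneg (mul_nonneg (by linarith) hL0)]
        nlinarith [mul_pos hY0 h01.1]
      · refine Eventually.of_forall fun t ht => ?_
        have ht0 := (ha N).trans_le (hIoc ht).1
        exact (tendsto_const_nhds.sub (hl t ht0)).mul (hLlim t ht0)
    have hlim2 : Tendsto (fun n => ∫ t in (a N)..x, (1 - Y t * W n t) * L (W n t)) atTop
        (𝓝 (l x - l (a N))) := by
      refine ((hl x ((ha N).trans_le hx.1)).sub (hl _ (ha N))).congr' ?_
      filter_upwards [eventually_ge_atTop N] with n hn
      have hdn : ∀ t ∈ Icc (a N) x, HasDerivWithinAt (fun z => Y z * W n z)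
          ((1 - Y t * W n t) * L (W n t)) (Icc (a N) x) t := fun t ht =>
        hasDerivWithinAt_mul_of_stepField h ((ha N).trans_le ht.1)
          ((hW n t (hsub hn (hI ht))).2.2.1.mono (hI.trans (hsub hn)))
      exact (intervalIntegral.integral_eq_sub_of_hasDerivAt_of_le hx.1
        (fun t ht => (hdn t ht).continuousWithinAt)
        (fun t ht => (hdn t (Ioo_subset_Icc_self ht)).hasDerivAt (Icc_mem_nhds ht.1 ht.2))
        ((hcontn n hn).intervalIntegrable_of_Icc hx.1)).symm
    exact tendsto_nhds_unique hlim1 hlim2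
  have hld : ∀ x, 0 < x → HasDerivAt l ((1 - l x) * L (w x)) x := fun x hx => by
    obtain ⟨N, hN⟩ := (hmem x hx).exists
    have hnhds : Icc (a N) (b N) ∈ 𝓝 x := Icc_mem_nhds hN.1 hN.2
    have h1 : HasDerivAt (fun y => ∫ t in (a N)..y, (1 - l t) * L (w t))
        ((1 - l x) * L (w x)) x := by
      refine intervalIntegral.integral_hasDerivAt_right
        (((hFc N).mono (Icc_subset_Icc_right hN.2.le)).intervalIntegrable_of_Icc hN.1.le) ?_
        ((hFc N).continuousAt hnhds)
      exact ((hFc N).mono Ioo_subset_Icc_self).stronglyMeasurableAtFilter isOpen_Ioo x hN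
    refine (h1.add_const (l (a N))).congr_of_eventuallyEq ?_
    filter_upwards [hnhds] with y hy
    rw [hWI N y hy]; ring
  refine ⟨w, fun x hx => ⟨huw x hx, hwlt x hx, hrate x hx, ?_, hstep x hx⟩⟩
  refine ((hld x hx).div (h.hasDerivAt_Y x hx) (h.Y_pos x hx).ne').congr_deriv ?_
  have hY := (h.Y_pos x hx).ne'
  rw [← hYw x hx]
  unfold stepField
  field_simp

/-- Any two consecutive factors are strictly ordered. -/
lemma lt_of_hasDerivAt_stepField {L Y u w : ℝ → ℝ} (h : IsProfile L Y u)
    (hle : ∀ x, 0 < x → u x ≤ w x)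
    (hw : ∀ x, 0 < x → HasDerivAt w (stepField L Y u x (w x)) x) {x : ℝ} (hx : 0 < x) :
    u x < w x := by
  refine (hle x hx).lt_of_ne fun heq => ?_
  obtain ⟨d, hd, -, hdle⟩ := h.hasDerivAt_u x hx
  have hmin : IsLocalMin (fun z => w z - u z) x := by
    filter_upwards [Ioi_mem_nhds hx] with z hz
    rw [← heq, sub_self]
    exact sub_nonneg.2 (hle z hz)
  have h0 := hmin.hasDerivAt_eq_zero ((hw x hx).sub hd)
  have := lt_stepField_self h hx hdle
  rw [heq] at this
  linarith

/-- Solutions of the next equation which are nondecreasing have positive derivative. -/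
lemma stepField_pos {L L' Y u w : ℝ → ℝ} (hL : IsRate L L') (h : IsProfile L Y u)
    (hw01 : ∀ x, 0 < x → 0 < w x ∧ w x < 1)
    (hw : ∀ x, 0 < x → HasDerivAt w (stepField L Y u x (w x)) x)
    (hnn : ∀ x, 0 < x → 0 ≤ stepField L Y u x (w x)) {x : ℝ} (hx : 0 < x) :
    0 < stepField L Y u x (w x) := by
  refine (hnn x hx).lt_of_ne' fun h0 => ?_
  have hnum : ∀ z, 0 < z → 0 ≤ (1 - Y z * w z) * L (w z) - w z * (1 - Y z) * L (u z) :=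
    fun z hz => by
      have hY := h.Y_pos z hz
      by_contra! hneg
      exact absurd (hnn z hz) (not_le.2 (div_neg_of_neg_of_pos hneg hY))
  have hnum0 : (1 - Y x * w x) * L (w x) - w x * (1 - Y x) * L (u x) = 0 :=
    (div_eq_zero_iff.1 h0).resolve_right (h.Y_pos x hx).ne'
  have hY0 := h.Y_pos x hx
  have hY1 := h.Y_lt x hx
  have hM := h.rate_pos x hx
  obtain ⟨hwx0, hwx1⟩ := hw01 x hx
  have hwd := hw x hx
  rw [h0] at hwd
  have hLd : HasDerivAt (fun z => L (w z)) 0 x :=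
    ((hL.hasDerivAt (w x) ⟨hwx0, hwx1⟩).comp x hwd).congr_deriv (mul_zero _)
  have hYd := h.hasDerivAt_Y x hx
  have hBd := (((hasDerivAt_const x (1 : ℝ)).sub (hYd.mul hwd)).mul hLd).sub
    ((hwd.mul ((hasDerivAt_const x (1 : ℝ)).sub hYd)).mul_const (L (u x)))
  have hslope := hasDerivWithinAt_iff_tendsto_slope' self_notMem_Iio |>.1
    (hBd.hasDerivWithinAt (s := Iio x))
  have hnonpos := le_of_tendsto hslope (b := 0) (by
    filter_upwards [Ioo_mem_nhdsLT hx] with z hz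
    rw [slope_def_field]
    refine div_nonpos_of_nonneg_of_nonpos ?_ (sub_nonpos.2 hz.2.le)
    simp only [Pi.mul_apply, Pi.sub_apply]
    rw [hnum0, sub_zero]
    refine (hnum z hz.1).trans (sub_le_sub_left ?_ _)
    exact mul_le_mul_of_nonneg_left (h.rate_anti hL hz.1 hx hz.2.le)
      (mul_nonneg (hw01 z hz.1).1.le (sub_nonneg.2 (h.Y_lt z hz.1).le)))
  simp only [Pi.mul_apply, Pi.sub_apply] at hnonpos
  have hlt : L (w x) < L (u x) := by
    by_contra! hcon
    have : w x * (1 - Y x) * L (u x) < (1 - Y x * w x) * L (w x) :=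
      mul_lt_mul (by nlinarith) hcon hM (by nlinarith)
    linarith
  have hpos : 0 < (1 - Y x) * L (u x) * w x * (L (u x) - L (w x)) :=
    mul_pos (mul_pos (mul_pos (by linarith) hM) hwx0) (by linarith)
  nlinarith

/-- The next equation has a solution on the half-line, with all the properties needed to
continue. -/
lemma IsProfile.exists_next {L L' Y u : ℝ → ℝ} (hL : IsRate L L') (h : IsProfile L Y u) :
    ∃ w : ℝ → ℝ, IsProfile L (fun x => Y x * w x) w ∧
      ∀ x, 0 < x → u x < w x ∧ HasDerivAt w (stepField L Y u x (w x)) x := by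
  obtain ⟨w, hw⟩ := exists_stepField_solution hL h
  have hle : ∀ x, 0 < x → u x ≤ w x := fun x hx => (hw x hx).1
  have hw01 : ∀ x, 0 < x → 0 < w x ∧ w x < 1 := fun x hx =>
    ⟨(h.u_pos x hx).trans_le (hle x hx), (hw x hx).2.1⟩
  have hd : ∀ x, 0 < x → HasDerivAt w (stepField L Y u x (w x)) x := fun x hx => (hw x hx).2.2.2.1
  have hnn : ∀ x, 0 < x → 0 ≤ stepField L Y u x (w x) := fun x hx => (hw x hx).2.2.2.2
  have hpos : ∀ᶠ x in 𝓝[>] (0 : ℝ), 0 < x := self_mem_nhdsWithin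
  refine ⟨w, ⟨fun x hx => mul_pos (h.Y_pos x hx) (hw01 x hx).1, fun x hx => ?_,
    fun x hx => (hw01 x hx).1, fun x hx => (hw01 x hx).2, fun x hx => (hw x hx).2.2.1,
    fun x hx => ?_, fun x hx => ⟨_, hd x hx, stepField_pos hL h hw01 hd hnn hx, ?_⟩, ?_, ?_⟩,
    fun x hx => ⟨lt_of_hasDerivAt_stepField h hle hd hx, hd x hx⟩⟩
  · have := h.Y_pos x hx
    have := h.Y_lt x hx
    have := hw01 x hx
    nlinarith
  · exact (hasDerivWithinAt_mul_of_stepField h hx (hd x hx).hasDerivWithinAt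
      (s := univ)).hasDerivAt univ_mem
  · have hY := h.Y_pos x hx
    have hY1 := h.Y_lt x hx
    have hwx := hw01 x hx
    have hLw : L (w x) ≤ L (u x) := hL.anti (h.mem hx) ⟨hwx.1, hwx.2.le⟩ (hle x hx)
    have e : L (w x) * (1 - w x) * (w x / (Y x * w x)) = L (w x) * (1 - w x) / Y x := by
      have := hwx.1.ne'
      field_simp
    rw [e]
    refine div_le_div_of_nonneg_right ?_ hY.le
    nlinarith [mul_nonneg (mul_nonneg hwx.1.le (sub_nonneg.2 hY1.le)) (sub_nonneg.2 hLw)]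
  · refine squeeze_zero' (hpos.mono fun x hx => (mul_pos (h.Y_pos x hx) (hw01 x hx).1).le)
      (hpos.mono fun x hx => ?_) h.tendsto_Y
    exact mul_le_of_le_one_right (h.Y_pos x hx).le (hw01 x hx).2.le
  · have hM : Tendsto (fun x => L (u x)) (𝓝[>] 0) atTop :=
      hL.tendsto_atTop.comp (tendsto_nhdsWithin_iff.2 ⟨h.tendsto_u, hpos.mono h.u_pos⟩)
    refine tendsto_order.2 ⟨fun c hc => hpos.mono fun x hx => hc.trans (hw01 x hx).1,
      fun c hc => ?_⟩
    rcases le_or_gt 1 c with h1 | h1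
    · exact hpos.mono fun x hx => (hw01 x hx).2.trans_le h1
    filter_upwards [hpos, hM.eventually_gt_atTop (2 * L c / c),
      h.tendsto_Y.eventually_lt_const one_half_pos] with x hx hMx hYx
    by_contra! hcw
    have hY := h.Y_pos x hx
    have hwx := hw01 x hx
    have hLw : L (w x) ≤ L c := hL.anti ⟨hc, h1.le⟩ ⟨hwx.1, hwx.2.le⟩ hcw
    have hLw0 := hL.nonneg ⟨hwx.1, hwx.2.le⟩
    have hLux := h.rate_pos x hx
    rw [div_lt_iff₀ hc] at hMx
    refine absurd (hnn x hx) (not_le.2 (div_neg_of_neg_of_pos (sub_neg.2 ?_) hY))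
    calc (1 - Y x * w x) * L (w x) ≤ L (w x) := by
          nlinarith [mul_nonneg (mul_pos hY hwx.1).le hLw0]
      _ ≤ L c := hLw
      _ < c * (1 / 2) * L (u x) := by linarith
      _ ≤ w x * (1 - Y x) * L (u x) := by
          refine mul_le_mul_of_nonneg_right ?_ hLux.le
          exact mul_le_mul hcw (by linarith) (by norm_num) hwx.1.le

/-- Separation of variables: a positive field on `(0, c)` which blows up at `0` and vanishes at
least linearly at `c` has an orbit starting from `0`, defined for all positive times. -/
lemma exists_autonomous_solution {N : ℝ → ℝ} {a c K : ℝ} (ha : 0 < a) (hac : a < c) (hK : 0 < K)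
    (hcont : ContinuousOn N (Ioo 0 c)) (hpos : ∀ s ∈ Ioo 0 c, 0 < N s)
    (htop : Tendsto N (𝓝[>] 0) atTop) (hle : ∀ s ∈ Ioo a c, N s ≤ K * (c - s)) :
    ∃ g : ℝ → ℝ, (∀ x, 0 < x → g x ∈ Ioo 0 c ∧ HasDerivAt g (N (g x)) x) ∧
      Tendsto g (𝓝[>] 0) (𝓝 0) := by
  have hc : 0 < c := ha.trans hac
  set f : ℝ → ℝ := fun s => if s ≤ 0 then 0 else (N s)⁻¹ with hf
  have hf_of_pos : ∀ s, 0 < s → f s = (N s)⁻¹ := fun s hs => if_neg hs.not_ge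
  have hf_cont : ContinuousOn f (Iio c) := by
    intro s hs
    refine ContinuousAt.continuousWithinAt ?_
    rcases lt_trichotomy s 0 with h | rfl | h
    · refine (continuousAt_const (y := (0 : ℝ))).congr ?_
      filter_upwards [Iio_mem_nhds h] with t ht
      exact (if_pos (le_of_lt ht)).symm
    · rw [continuousAt_iff_continuous_left'_right']
      have h0 : f 0 = 0 := if_pos le_rfl
      constructor
      · refine (continuousWithinAt_const (b := (0 : ℝ))).congr (fun t ht => if_pos (le_of_lt ht)) h0
      · have := (tendsto_inv_atTop_zero.comp htop)
        unfold ContinuousWithinAt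
        rw [h0]
        refine this.congr' ?_
        filter_upwards [self_mem_nhdsWithin] with t ht
        exact (hf_of_pos t ht).symm
    · have hN : ContinuousAt N s := hcont.continuousAt (Ioo_mem_nhds h hs)
      refine (hN.inv₀ (hpos s ⟨h, hs⟩).ne').congr ?_
      filter_upwards [Ioi_mem_nhds h] with t ht
      exact (hf_of_pos t ht).symm
  set H : ℝ → ℝ := fun t => ∫ s in (0 : ℝ)..t, f s with hH
  have hHd : ∀ t, t < c → HasDerivAt H (f t) t := by
    intro t ht
    refine intervalIntegral.integral_hasDerivAt_right ?_ ?_ (hf_cont.continuousAt (Iio_mem_nhds ht))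
    · refine (hf_cont.mono fun s hs => ?_).intervalIntegrable
      exact hs.2.trans_lt (max_lt hc ht)
    · exact hf_cont.stronglyMeasurableAtFilter isOpen_Iio t ht
  have hH0 : H 0 = 0 := intervalIntegral.integral_same
  have hHmono : StrictMonoOn H (Ico 0 c) := by
    refine strictMonoOn_of_deriv_pos (convex_Ico 0 c)
      (fun t ht => (hHd t ht.2).continuousAt.continuousWithinAt) fun t ht => ?_
    rw [interior_Ico] at ht
    rw [(hHd t ht.2).deriv, hf_of_pos t ht.1]
    exact inv_pos.2 (hpos t ht)
  have hHcont : ContinuousOn H (Ico 0 c) :=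
    fun t ht => (hHd t ht.2).continuousAt.continuousWithinAt
  have hlow : MonotoneOn (fun t => H t + K⁻¹ * Real.log (c - t)) (Ico a c) := by
    have hd : ∀ t, t < c → HasDerivAt (fun t => H t + K⁻¹ * Real.log (c - t))
        (f t + K⁻¹ * (-1 / (c - t))) t := fun t ht =>
      (hHd t ht).add (((hasDerivAt_id t).const_sub c |>.log (sub_pos.2 ht).ne').const_mul _)
    refine monotoneOn_of_deriv_nonneg (convex_Ico a c)
      (fun t ht => (hd t ht.2).continuousAt.continuousWithinAt)
      (fun t ht => ?_) fun t ht => ?_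
    · rw [interior_Ico] at ht
      exact (hd t ht.2).differentiableAt.differentiableWithinAt
    · rw [interior_Ico] at ht
      have htc : 0 < c - t := sub_pos.2 ht.2
      rw [(hd t ht.2).deriv, hf_of_pos t (ha.trans ht.1)]
      have h1 : (K * (c - t))⁻¹ ≤ (N t)⁻¹ :=
        inv_anti₀ (hpos t ⟨ha.trans ht.1, ht.2⟩) (hle t ht)
      have h2 : K⁻¹ * (-1 / (c - t)) = -(K * (c - t))⁻¹ := by
        rw [mul_inv]; ring
      linarith
  have hsurj : ∀ x, 0 < x → ∃ t ∈ Ioo 0 c, H t = x := by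
    intro x hx
    set b := c - (c - a) * Real.exp (-(K * x)) with hb
    have hca : 0 < c - a := sub_pos.2 hac
    have hexp : Real.exp (-(K * x)) < 1 := by simpa using mul_pos hK hx
    have hbc : b < c := by have := mul_pos hca (Real.exp_pos (-(K * x))); linarith
    have hab : a < b := by
      have := mul_lt_mul_of_pos_left hexp hca
      linarith
    have hHa : 0 < H a := hH0 ▸ hHmono ⟨le_rfl, hc⟩ ⟨ha.le, hac⟩ ha
    have hxb : x < H b := by
      have h1 := hlow ⟨le_rfl, hac⟩ ⟨hab.le, hbc⟩ hab.le
      have h2 : Real.log (c - b) = Real.log (c - a) + -(K * x) := by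
        rw [hb, sub_sub_cancel, Real.log_mul hca.ne' (Real.exp_pos _).ne', Real.log_exp]
      simp only [h2] at h1
      have h3 : K⁻¹ * (Real.log (c - a) + -(K * x)) = K⁻¹ * Real.log (c - a) - x := by
        field_simp
        ring
      linarith
    obtain ⟨t, ht, hxt⟩ := intermediate_value_Ioo (ha.trans hab).le
      (hHcont.mono fun t ht => ⟨ht.1, ht.2.trans_lt hbc⟩) ⟨hH0.symm ▸ hx, hxb⟩
    exact ⟨t, ⟨ht.1, ht.2.trans hbc⟩, hxt⟩
  choose! g hg hgH using hsurj
  have hIco : ∀ {t}, t ∈ Ioo 0 c → t ∈ Ico 0 c := fun ht => ⟨ht.1.le, ht.2⟩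
  have hgmono : StrictMonoOn g (Ioi 0) := fun x hx y hy hxy => by
    rwa [← hHmono.lt_iff_lt (hIco (hg x hx)) (hIco (hg y hy)), hgH x hx, hgH y hy]
  have hgimage : g '' Ioi 0 = Ioo 0 c := by
    refine subset_antisymm (image_subset_iff.2 fun x hx => hg x hx) fun t ht => ?_
    have hHt : 0 < H t := hH0 ▸ hHmono ⟨le_rfl, hc⟩ (hIco ht) ht.1
    exact ⟨H t, hHt, hHmono.injOn (hIco (hg _ hHt)) (hIco ht) (hgH _ hHt)⟩
  refine ⟨g, fun x hx => ⟨hg x hx, ?_⟩, ?_⟩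
  · have hgc : ContinuousAt g x := hgmono.continuousAt_of_image_mem_nhds (Ioi_mem_nhds hx)
      (hgimage.symm ▸ Ioo_mem_nhds (hg x hx).1 (hg x hx).2)
    have hd := hHd (g x) (hg x hx).2
    rw [hf_of_pos _ (hg x hx).1] at hd
    have := hd.of_local_left_inverse hgc (inv_ne_zero (hpos _ (hg x hx)).ne') <| by
      filter_upwards [Ioi_mem_nhds hx] with y hy
      exact hgH y hy
    rwa [inv_inv] at this
  · rw [tendsto_order]
    refine ⟨fun b hb => ?_, fun b hb => ?_⟩
    · filter_upwards [self_mem_nhdsWithin] with x hx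
      exact hb.trans (hg x hx).1
    · set e := min b a with he
      have he0 : 0 < e := lt_min hb ha
      have hec : e < c := (min_le_right _ _).trans_lt hac
      have hHe : 0 < H e := hH0 ▸ hHmono ⟨le_rfl, hc⟩ ⟨he0.le, hec⟩ he0
      filter_upwards [Ioo_mem_nhdsGT hHe] with x hx
      refine lt_of_lt_of_le ?_ (min_le_left b a)
      rw [← hHmono.lt_iff_lt (hIco (hg x hx.1)) ⟨he0.le, hec⟩, hgH x hx.1]
      exact hx.2

/-- The solution of the first equation. -/
lemma exists_first_profile {L L' : ℝ → ℝ} (hL : IsRate L L') : ∃ u, IsProfile L u u := by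
  obtain ⟨δ, hδ, hδpos⟩ : ∃ δ : ℝ, 0 < δ ∧ ∀ s ∈ Ioo 0 δ, 0 < L s := by
    obtain ⟨δ, hδ, h⟩ := mem_nhdsGT_iff_exists_Ioo_subset.1 (hL.tendsto_atTop.eventually_gt_atTop 0)
    exact ⟨δ, hδ, fun s hs => h hs⟩
  obtain ⟨c, ⟨hc, hcL⟩, hcmin⟩ :
      ∃ c, IsLeast {s ∈ Icc (min δ 1 / 2) 1 | L s = 0} c := by
    have h0 : 0 < min δ 1 / 2 := half_pos (lt_min hδ one_pos)
    refine IsCompact.exists_isLeast ?_ ⟨1, ⟨?_, le_rfl⟩, hL.one⟩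
    · refine isCompact_Icc.of_isClosed_subset ?_ fun s hs => hs.1
      exact (hL.cont.mono fun s hs => ⟨h0.trans_le hs.1, hs.2⟩).preimage_isClosed_of_isClosed
        isClosed_Icc (isClosed_singleton (x := (0 : ℝ)))
    · have := min_le_right δ 1
      linarith
  have h0 : 0 < min δ 1 / 2 := half_pos (lt_min hδ one_pos)
  have hc0 : 0 < c := h0.trans_le hc.1
  have hLpos : ∀ s ∈ Ioo 0 c, 0 < L s := by
    intro s hs
    rcases lt_or_ge s (min δ 1 / 2) with h | h
    · refine hδpos s ⟨hs.1, ?_⟩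
      have := min_le_left δ 1
      linarith
    · refine lt_of_le_of_ne (hL.nonneg ⟨hs.1, hs.2.le.trans hc.2⟩) fun h' => ?_
      exact hs.2.not_ge (hcmin ⟨⟨h, hs.2.le.trans hc.2⟩, h'.symm⟩)
  obtain ⟨a, K, ha, hac, hK, hle⟩ : ∃ a K : ℝ, 0 < a ∧ a < c ∧ 0 < K ∧
      ∀ s ∈ Ioo a c, (1 - s) * L s ≤ K * (c - s) := by
    rcases hc.2.eq_or_lt with rfl | hc1
    · refine ⟨1 / 2, L (1 / 2), by norm_num, by norm_num, hLpos _ (by norm_num), fun s hs => ?_⟩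
      rw [mul_comm]
      have hs0 : (0 : ℝ) < s := lt_trans (by norm_num) hs.1
      exact mul_le_mul_of_nonneg_right
        (hL.anti (by norm_num) ⟨hs0, hs.2.le⟩ hs.1.le) (sub_nonneg.2 hs.2.le)
    · obtain ⟨K, hK, hO⟩ := (hL.hasDerivAt c ⟨hc0, hc1⟩).isBigO_sub.exists_pos
      obtain ⟨a, ha, hsub⟩ := (mem_nhdsLT_iff_exists_Ioo_subset' hc0).1
        (mem_nhdsWithin_of_mem_nhds hO.bound)
      refine ⟨max a (c / 2), K, lt_max_of_lt_right (half_pos hc0),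
        max_lt ha (half_lt_self hc0), hK, fun s hs => ?_⟩
      have hs0 : 0 < s := (half_pos hc0).trans ((le_max_right _ _).trans_lt hs.1)
      have h1 : ‖L s - L c‖ ≤ K * ‖s - c‖ := hsub ⟨(le_max_left _ _).trans_lt hs.1, hs.2⟩
      rw [hcL, sub_zero, Real.norm_eq_abs, Real.norm_eq_abs, abs_sub_comm s c,
        abs_of_pos (sub_pos.2 hs.2), abs_of_pos (hLpos s ⟨hs0, hs.2⟩)] at h1
      nlinarith [mul_pos hs0 (hLpos s ⟨hs0, hs.2⟩)]
  have hlt1 : ∀ s ∈ Ioo 0 c, s < 1 := fun s hs => hs.2.trans_le hc.2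
  obtain ⟨u, hu, hu0⟩ := exists_autonomous_solution (N := fun s => (1 - s) * L s) ha hac hK
    ((continuousOn_const.sub continuousOn_id).mul
      (hL.cont.mono fun s hs => ⟨hs.1, hs.2.le.trans hc.2⟩))
    (fun s hs => mul_pos (sub_pos.2 (hlt1 s hs)) (hLpos s hs))
    (by
      have h1 : Tendsto (fun s : ℝ => 1 - s) (𝓝[>] 0) (𝓝 1) := by
        have : Tendsto (fun s : ℝ => 1 - s) (𝓝 0) (𝓝 (1 - 0)) := tendsto_id.const_sub 1
        rw [sub_zero] at this
        exact this.mono_left nhdsWithin_le_nhds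
      exact h1.pos_mul_atTop one_pos hL.tendsto_atTop) hle
  have hupos : ∀ x, 0 < x → 0 < u x := fun x hx => (hu x hx).1.1
  have hult : ∀ x, 0 < x → u x < 1 := fun x hx => hlt1 _ (hu x hx).1
  refine ⟨u, hupos, hult, hupos, hult, fun x hx => hLpos _ (hu x hx).1, fun x hx => (hu x hx).2,
    fun x hx => ⟨_, (hu x hx).2, mul_pos (sub_pos.2 (hult x hx)) (hLpos _ (hu x hx).1), ?_⟩,
    hu0, hu0⟩
  rw [div_self (hupos x hx).ne', mul_one, mul_comm]

/-- In the setting of `PQContext`, `r` is the inverse of `q` as a map of `[0, 1]`. -/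
structure IsInverse (q q' r : ℝ → ℝ) : Prop where
  mapsTo : ∀ u ∈ Icc (0 : ℝ) 1, r u ∈ Icc (0 : ℝ) 1
  right_inv : ∀ u ∈ Icc (0 : ℝ) 1, q (r u) = u
  zero : r 0 = 1
  one : r 1 = 0
  anti : StrictAntiOn r (Icc 0 1)
  cont : ContinuousOn r (Icc 0 1)
  hasDerivAt : ∀ u ∈ Ioo (0 : ℝ) 1, HasDerivAt r (q' (r u))⁻¹ u

lemma IsInverse.mem_Ioo {q q' r : ℝ → ℝ} (h : IsInverse q q' r) {u : ℝ} (hu : u ∈ Ioo (0 : ℝ) 1) :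
    r u ∈ Ioo (0 : ℝ) 1 := by
  constructor
  · simpa only [h.one] using h.anti (Ioo_subset_Icc_self hu) (right_mem_Icc.2 zero_le_one) hu.2
  · simpa only [h.zero] using h.anti (left_mem_Icc.2 zero_le_one) (Ioo_subset_Icc_self hu) hu.1

namespace PQContext

variable {p q p' q' : ℝ → ℝ}

lemma exists_isInverse (hpq : PQContext p q p' q') : ∃ r, IsInverse q q' r := by
  obtain ⟨-, hq, -, hqd, -, -, -, hq0, -, hq1, -, -, hqneg⟩ := hpq
  have hqd' : ∀ t ∈ Ioo (0 : ℝ) 1, HasDerivAt q (q' t) t := fun t ht =>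
    (hqd t (Ioo_subset_Ioc_self ht)).hasDerivAt (Ioc_mem_nhds ht.1 ht.2)
  have hanti : StrictAntiOn q (Icc 0 1) := by
    refine strictAntiOn_of_deriv_neg (convex_Icc 0 1) hq fun t ht => ?_
    rw [interior_Icc] at ht
    rw [(hqd' t ht).deriv]
    exact hqneg t (Ioo_subset_Ioc_self ht)
  have hmem0 : (0 : ℝ) ∈ Icc (0 : ℝ) 1 := left_mem_Icc.2 zero_le_one
  have hmem1 : (1 : ℝ) ∈ Icc (0 : ℝ) 1 := right_mem_Icc.2 zero_le_one
  have himage : q '' Icc 0 1 = Icc 0 1 := by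
    refine subset_antisymm (image_subset_iff.2 fun t ht => ⟨?_, ?_⟩) ?_
    · exact hq1 ▸ hanti.antitoneOn ht hmem1 ht.2
    · exact hq0 ▸ hanti.antitoneOn hmem0 ht ht.1
    · have := intermediate_value_Icc' zero_le_one hq
      rwa [hq0, hq1] at this
  have hsurj : ∀ u ∈ Icc (0 : ℝ) 1, ∃ t ∈ Icc (0 : ℝ) 1, q t = u := fun u hu =>
    himage.symm.subset hu
  choose! r hr hqr using hsurj
  have hrq : ∀ t ∈ Icc (0 : ℝ) 1, r (q t) = t := fun t ht => by
    have : q t ∈ Icc (0 : ℝ) 1 := himage.subset (mem_image_of_mem q ht)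
    exact hanti.injOn (hr _ this) ht (hqr _ this)
  have hr_anti : StrictAntiOn r (Icc 0 1) := fun u hu v hv huv => by
    rwa [← hanti.lt_iff_gt (hr u hu) (hr v hv), hqr u hu, hqr v hv]
  have hr_image : r '' Icc 0 1 = Icc 0 1 := subset_antisymm (image_subset_iff.2 hr) fun t ht =>
    ⟨q t, himage.subset (mem_image_of_mem q ht), hrq t ht⟩
  have hr_cont : ContinuousOn r (Icc 0 1) := by
    refine continuousOn_iff_isClosed.2 fun t ht => ⟨q '' (Icc 0 1 ∩ t), ?_, ?_⟩
    · exact ((isCompact_Icc.inter_right ht).image_of_continuousOn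
        (hq.mono inter_subset_left)).isClosed
    · ext u
      constructor
      · exact fun hu => ⟨⟨r u, ⟨hr u hu.2, hu.1⟩, hqr u hu.2⟩, hu.2⟩
      · rintro ⟨⟨s, hs, rfl⟩, hu⟩
        refine ⟨?_, hu⟩
        rw [mem_preimage, hrq s hs.1]
        exact hs.2
  have hr0 : r 0 = 1 := hq1 ▸ hrq 1 hmem1
  have hr1 : r 1 = 0 := hq0 ▸ hrq 0 hmem0
  refine ⟨r, hr, hqr, hr0, hr1, hr_anti, hr_cont, fun u hu => ?_⟩
  have hru : r u ∈ Ioo (0 : ℝ) 1 := by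
    constructor
    · exact hr1 ▸ hr_anti (Ioo_subset_Icc_self hu) hmem1 hu.2
    · exact hr0 ▸ hr_anti hmem0 (Ioo_subset_Icc_self hu) hu.1
  refine (hqd' _ hru).of_local_left_inverse
    (hr_cont.continuousAt (Icc_mem_nhds hu.1 hu.2)) (hqneg _ (Ioo_subset_Ioc_self hru)).ne ?_
  filter_upwards [Icc_mem_nhds hu.1 hu.2] with v hv
  exact hqr v hv

lemma isRate (hpq : PQContext p q p' q') {r : ℝ → ℝ} (hr : IsInverse q q' r) :
    IsRate (fun u => -Real.log (p (r u)))
      (fun u => -(p' (r u) * (q' (r u))⁻¹ / p (r u))) := by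
  obtain ⟨hp, -, hpd, -, hp'c, hq'c, hp0, -, hp1, -, hppos, hp', hqneg⟩ := hpq
  have hpd' : ∀ t ∈ Ioo (0 : ℝ) 1, HasDerivAt p (p' t) t := fun t ht =>
    (hpd t (Ioo_subset_Ioc_self ht)).hasDerivAt (Ioc_mem_nhds ht.1 ht.2)
  have hp_anti : AntitoneOn p (Icc 0 1) := by
    refine antitoneOn_of_deriv_nonpos (convex_Icc 0 1) hp (fun t ht => ?_) fun t ht => ?_
    · rw [interior_Icc] at ht
      exact (hpd' t ht).differentiableAt.differentiableWithinAt
    · rw [interior_Icc] at ht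
      rw [(hpd' t ht).deriv]
      exact hp' t (Ioo_subset_Ioc_self ht)
  have hr_mem : ∀ u ∈ Ioc (0 : ℝ) 1, r u ∈ Ico (0 : ℝ) 1 := fun u hu =>
    ⟨(hr.mapsTo u (Ioc_subset_Icc_self hu)).1, by
      simpa only [hr.zero] using hr.anti (left_mem_Icc.2 zero_le_one) (Ioc_subset_Icc_self hu) hu.1⟩
  have hprc : ContinuousOn (fun u => p (r u)) (Icc 0 1) := hp.comp hr.cont hr.mapsTo
  have hrc : ContinuousOn r (Ioo 0 1) := hr.cont.mono Ioo_subset_Icc_self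
  have hr_maps : MapsTo r (Ioo 0 1) (Ioc 0 1) := fun u hu =>
    Ioo_subset_Ioc_self (hr.mem_Ioo hu)
  refine ⟨fun u hu v hv huv => ?_, ?_, ?_, ?_, fun u hu => ?_, ?_⟩
  · have hle : p (r u) ≤ p (r v) :=
      hp_anti (hr.mapsTo v (Ioc_subset_Icc_self hv))
        (hr.mapsTo u (Ioc_subset_Icc_self hu))
        (hr.anti.antitoneOn (Ioc_subset_Icc_self hu) (Ioc_subset_Icc_self hv) huv)
    exact neg_le_neg (Real.log_le_log (hppos _ (hr_mem u hu)) hle)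
  · exact ((hprc.mono Ioc_subset_Icc_self).log fun u hu => (hppos _ (hr_mem u hu)).ne').neg
  · simp [hr.one, hp0]
  · refine tendsto_neg_atBot_atTop.comp (Real.tendsto_log_nhdsGT_zero.comp ?_)
    refine tendsto_nhdsWithin_iff.2 ⟨?_, ?_⟩
    · have hmem : Icc (0 : ℝ) 1 ∈ 𝓝[>] 0 := Icc_mem_nhdsGT zero_lt_one
      have h : Tendsto (fun u => p (r u)) (𝓝[Icc 0 1] 0) (𝓝 (p (r 0))) :=
        hprc 0 (left_mem_Icc.2 zero_le_one)
      have h' := h.mono_left (nhdsWithin_le_of_mem hmem)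
      rwa [hr.zero, hp1] at h'
    · filter_upwards [Ioc_mem_nhdsGT zero_lt_one] with u hu
      exact hppos _ (hr_mem u hu)
  · have := (((hpd' _ (hr.mem_Ioo hu)).comp u (hr.hasDerivAt u hu)).log
      (hppos _ (hr_mem u (Ioo_subset_Ioc_self hu))).ne').neg
    exact this
  · exact (((hp'c.comp hrc hr_maps).mul ((hq'c.comp hrc hr_maps).inv₀
      fun u hu => (hqneg _ (hr_maps hu)).ne)).div (hprc.mono Ioo_subset_Icc_self)
      fun u hu => (hppos _ (hr_mem u (Ioo_subset_Ioc_self hu))).ne').neg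

end PQContext

/-- The sequence of the factors `u n = q ∘ T_{n + 1}`, with their products `Y n`. -/
lemma exists_profile_seq {L L' : ℝ → ℝ} (hL : IsRate L L') :
    ∃ Y u : ℕ → ℝ → ℝ, (∀ n, IsProfile L (Y n) (u n)) ∧ Y 0 = u 0 ∧
      (∀ n x, Y (n + 1) x = Y n x * u (n + 1) x) ∧
      ∀ n x, 0 < x → u n x < u (n + 1) x ∧
        HasDerivAt (u (n + 1)) (stepField L (Y n) (u n) x (u (n + 1) x)) x := by
  obtain ⟨u₀, hu₀⟩ := exists_first_profile hL
  choose! next hnext using fun (Y u : ℝ → ℝ) (h : IsProfile L Y u) => h.exists_next hL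
  let s : ℕ → (ℝ → ℝ) × (ℝ → ℝ) := fun n => n.rec (u₀, u₀)
    fun _ P => (fun x => P.1 x * next P.1 P.2 x, next P.1 P.2)
  have hs : ∀ n, IsProfile L (s n).1 (s n).2 := by
    intro n
    induction n with
    | zero => exact hu₀
    | succ n ih => exact (hnext _ _ ih).1
  exact ⟨fun n => (s n).1, fun n => (s n).2, hs, rfl, fun n x => rfl,
    fun n x hx => (hnext _ _ (hs n)).2 x hx⟩

/-- The function `T` with `q ∘ T = u` on `(0, ∞)` and `T = r 0` on `(-∞, 0]`. -/
noncomputable def pullback (r u : ℝ → ℝ) (x : ℝ) : ℝ :=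
  r (if 0 < x then u x else 0)

lemma pullback_of_pos (r u : ℝ → ℝ) {x : ℝ} (hx : 0 < x) : pullback r u x = r (u x) := by
  rw [pullback, if_pos hx]

namespace IsInverse

variable {q q' r L Y u : ℝ → ℝ}

lemma pullback_zero (hr : IsInverse q q' r) (u : ℝ → ℝ) : pullback r u 0 = 1 := by
  rw [pullback, if_neg (lt_irrefl 0), hr.zero]

lemma pullback_mem_Ioo (hr : IsInverse q q' r) (h : IsProfile L Y u) {x : ℝ} (hx : 0 < x) :
    pullback r u x ∈ Ioo (0 : ℝ) 1 := by
  rw [pullback_of_pos r u hx]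
  exact hr.mem_Ioo ⟨h.u_pos x hx, h.u_lt x hx⟩

lemma apply_pullback (hr : IsInverse q q' r) (h : IsProfile L Y u) {x : ℝ} (hx : 0 < x) :
    q (pullback r u x) = u x := by
  rw [pullback_of_pos r u hx, hr.right_inv _ ⟨(h.u_pos x hx).le, (h.u_lt x hx).le⟩]

lemma hasDerivAt_pullback (hr : IsInverse q q' r) (h : IsProfile L Y u) {x d : ℝ} (hx : 0 < x)
    (hd : HasDerivAt u d x) : HasDerivAt (pullback r u) ((q' (pullback r u x))⁻¹ * d) x := by
  rw [pullback_of_pos r u hx]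
  refine ((hr.hasDerivAt (u x) ⟨h.u_pos x hx, h.u_lt x hx⟩).comp x hd).congr_of_eventuallyEq ?_
  filter_upwards [Ioi_mem_nhds hx] with y hy
  exact pullback_of_pos r u hy

lemma continuousOn_pullback (hr : IsInverse q q' r) (h : IsProfile L Y u) :
    ContinuousOn (pullback r u) (Ici 0) := by
  intro x hx
  rcases (mem_Ici.1 hx).eq_or_lt with rfl | hx
  · rw [← Ioi_insert, continuousWithinAt_insert_self]
    have h1 : Tendsto u (𝓝[>] 0) (𝓝[Icc 0 1] 0) := by
      refine tendsto_nhdsWithin_iff.2 ⟨h.tendsto_u, ?_⟩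
      filter_upwards [self_mem_nhdsWithin] with x hx
      exact Ioc_subset_Icc_self (h.mem hx)
    have h2 : Tendsto r (𝓝[Icc 0 1] 0) (𝓝 (r 0)) := hr.cont 0 (left_mem_Icc.2 zero_le_one)
    have h3 : Tendsto (pullback r u) (𝓝[>] 0) (𝓝 (r 0)) := by
      refine (h2.comp h1).congr' ?_
      filter_upwards [self_mem_nhdsWithin] with x hx
      exact (pullback_of_pos r u hx).symm
    rw [hr.zero, ← hr.pullback_zero u] at h3
    exact h3
  · obtain ⟨d, hd, -⟩ := h.hasDerivAt_u x hx
    exact (hr.hasDerivAt_pullback h hx hd).continuousAt.continuousWithinAt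

lemma contDiffOn_pullback (hr : IsInverse q q' r) (h : IsProfile L Y u)
    (hq' : ContinuousOn q' (Ioc 0 1)) (hneg : ∀ t ∈ Ioc (0 : ℝ) 1, q' t < 0) {d : ℝ → ℝ}
    (hd : ∀ x, 0 < x → HasDerivAt u (d x) x) (hdc : ContinuousOn d (Ioi 0)) :
    ContDiffOn ℝ 1 (pullback r u) (Ioi 0) := by
  have hT : ∀ x, 0 < x → HasDerivAt (pullback r u) ((q' (pullback r u x))⁻¹ * d x) x :=
    fun x hx => hr.hasDerivAt_pullback h hx (hd x hx)
  have hmaps : MapsTo (pullback r u) (Ioi 0) (Ioc 0 1) := fun x hx =>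
    Ioo_subset_Ioc_self (hr.pullback_mem_Ioo h hx)
  rw [contDiffOn_one_iff_derivWithin (uniqueDiffOn_Ioi 0)]
  refine ⟨fun x hx => (hT x hx).differentiableAt.differentiableWithinAt, ?_⟩
  refine ContinuousOn.congr (f := fun x => (q' (pullback r u x))⁻¹ * d x) ?_
    fun x hx => (hT x hx).hasDerivWithinAt.derivWithin (uniqueDiffOn_Ioi 0 x hx)
  refine ContinuousOn.mul (ContinuousOn.inv₀ (hq'.comp ?_ hmaps)
    fun x hx => (hneg _ (hmaps hx)).ne) hdc
  exact fun x hx => (hT x hx).continuousAt.continuousWithinAt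

end IsInverse

/-- Lemma 2. The system (difeq) of ordinary differential equations
with initial conditions `T_k 0 = 1` (`k ≥ 1`) has a solution `(T_k)_{k ≥ 1}` defined
on the whole half-line `x > 0`, and this solution belongs to the class `𝒯`. -/
theorem difeq_has_solution_in_classT
    (p q p' q' : ℝ → ℝ) (hpq : PQContext p q p' q') :
    ∃ T : ℕ → ℝ → ℝ, IsClassT T ∧
      ∀ x > (0 : ℝ), ∀ k, 1 ≤ k → deriv (T k) x = difeqRHS p q q' T k x := by
  obtain ⟨r, hr⟩ := hpq.exists_isInverse
  have hL := hpq.isRate hr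
  obtain ⟨-, -, -, -, -, hq', -, -, -, -, -, -, hneg⟩ := hpq
  set L : ℝ → ℝ := fun u => -Real.log (p (r u)) with hLdef
  obtain ⟨Y, u, h, hY0, hYsucc, hstep⟩ := exists_profile_seq hL
  have hlog : ∀ n x, 0 < x → Real.log (p (pullback r (u n) x)) = -L (u n x) := by
    intro n x hx
    rw [pullback_of_pos r _ hx, hLdef, neg_neg]
  have hprod : ∀ n x, 0 < x →
      ∏ i ∈ Finset.Icc 1 (n + 1), q (pullback r (u (i - 1)) x) = Y n x := by
    intro n x hx
    induction n with
    | zero => simp [hr.apply_pullback (h 0) hx, hY0]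
    | succ n ih =>
      rw [Finset.prod_Icc_succ_top (by omega), ih, hYsucc, Nat.add_sub_cancel,
        hr.apply_pullback (h _) hx]
  have hderiv_zero : ∀ x, 0 < x → HasDerivAt (u 0) ((1 - u 0 x) * L (u 0 x)) x := fun x hx => by
    have := (h 0).hasDerivAt_Y x hx
    rwa [hY0] at this
  have hcont_u : ∀ n, ContinuousOn (u n) (Ioi 0) := fun n x hx =>
    ((h n).continuousAt_u hx).continuousWithinAt
  have hcont_Y : ∀ n, ContinuousOn (Y n) (Ioi 0) := fun n x hx =>
    ((h n).hasDerivAt_Y x hx).continuousAt.continuousWithinAt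
  have hcont_L : ∀ n, ContinuousOn (fun x => L (u n x)) (Ioi 0) := fun n x hx =>
    ((h n).continuousAt_rate hL hx).continuousWithinAt
  refine ⟨fun k => pullback r (u (k - 1)), fun k hk => ?_, fun x hx k hk => ?_⟩
  · obtain ⟨n, rfl⟩ : ∃ n, k = n + 1 := ⟨k - 1, by omega⟩
    simp only [Nat.add_sub_cancel]
    refine ⟨hr.continuousOn_pullback (h n), ?_, fun x hx => ?_, fun x hx => ?_, fun x hx => ?_,
      hr.pullback_zero _⟩
    · cases n with
      | zero =>
        exact hr.contDiffOn_pullback (h 0) hq' hneg hderiv_zero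
          ((continuousOn_const.sub (hcont_u 0)).mul (hcont_L 0))
      | succ n =>
        refine hr.contDiffOn_pullback (h _) hq' hneg (fun x hx => (hstep n x hx).2) ?_
        exact ((((continuousOn_const.sub ((hcont_Y n).mul (hcont_u _))).mul (hcont_L _)).sub
          (((hcont_u _).mul (continuousOn_const.sub (hcont_Y n))).mul (hcont_L n))).div
          (hcont_Y n) fun x hx => ((h n).Y_pos x hx).ne')
    · rcases hx.eq_or_lt with rfl | hx
      · rw [hr.pullback_zero]
        exact ⟨one_pos, le_rfl⟩
      · exact Ioo_subset_Ioc_self (hr.pullback_mem_Ioo (h n) hx)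
    · obtain ⟨d, hd, hpos, -⟩ := (h n).hasDerivAt_u x hx
      rw [(hr.hasDerivAt_pullback (h n) hx hd).deriv]
      exact mul_neg_of_neg_of_pos
        (inv_lt_zero.2 (hneg _ (Ioo_subset_Ioc_self (hr.pullback_mem_Ioo (h n) hx)))) hpos
    · rw [pullback_of_pos r _ hx, pullback_of_pos r _ hx]
      exact hr.anti (Ioc_subset_Icc_self ((h n).mem hx))
        (Ioc_subset_Icc_self ((h (n + 1)).mem hx)) (hstep n x hx).1
  · obtain ⟨n, rfl⟩ : ∃ n, k = n + 1 := ⟨k - 1, by omega⟩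
    have hq'0 : q' (pullback r (u n) x) ≠ 0 :=
      (hneg _ (Ioo_subset_Ioc_self (hr.pullback_mem_Ioo (h n) hx))).ne
    rw [difeqRHS, hprod n x hx]
    simp only [Nat.add_sub_cancel]
    rw [hlog n x hx, hr.apply_pullback (h n) hx]
    cases n with
    | zero =>
      rw [(hr.hasDerivAt_pullback (h 0) hx (hderiv_zero x hx)).deriv, hY0]
      simp
      field_simp
    | succ n =>
      have hY := ((h n).Y_pos x hx).ne'
      rw [(hr.hasDerivAt_pullback (h _) hx (hstep n x hx).2).deriv, hprod n x hx, hYsucc,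
        Nat.add_sub_cancel, hlog n x hx, stepField]
      field_simp
      ring
end

section
/- Suppose q(t)=1−t (i.e. P₂(t)=t), and let T₁,…,T_{k−1} be the functions of the solution of the first k−1 equations of the system (difeq) constructed in Lemma 2 (so T_i'(x)<0, T_{i+1}(x)<T_i(x), T_i(0)=1, 0<T_i(x)≤1). Put π_{k−1}(x)=∏_{i=1}^{k−1} q(T_i(x)), Φ_k(t,x)=φ_k(T₁(x),…,T_{k−1}(x),t), and let f_k(x) be the unique solution t∈(0,T_{k−1}(x)) of F_k(t,x)=0, where F_k(t,x)=(1−π_{k−1}(x)q(t))·log p(t) − (1−π_{k−1}(x))·q(t)·log p(T_{k−1}(x)). If y and z are solutions of the scalar ODE u'(x)=Φ_k(u(x),x) on the half-line [a,∞) (a>0) with initial values satisfying f_k(a) ≤ z(a) < y(a) ≤ T_{k−1}(a), then the difference e(x)=y(x)−z(x) is strictly decreasing in x on [a,∞). -/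
open Set

/-- `π_j(x) = ∏_{i=1}^{j} q (T_i x)`. -/
noncomputable def prodPi (q : ℝ → ℝ) (T : ℕ → ℝ → ℝ) (j : ℕ) (x : ℝ) : ℝ :=
  ∏ i ∈ Finset.Icc 1 j, q (T i x)

/-- `F_k(t,x) = (1 - π_{k-1}(x) q(t)) log p(t) - (1 - π_{k-1}(x)) q(t) log p(T_{k-1} x)`. -/
noncomputable def Fk (p q : ℝ → ℝ) (T : ℕ → ℝ → ℝ) (k : ℕ) (t x : ℝ) : ℝ :=
  (1 - prodPi q T (k - 1) x * q t) * Real.log (p t)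
    - (1 - prodPi q T (k - 1) x) * q t * Real.log (p (T (k - 1) x))

/-- `Φ_k(t,x) = φ_k(T₁(x), …, T_{k-1}(x), t) = -F_k(t,x) / (q'(t) π_{k-1}(x))`. -/
noncomputable def Phik (p q q' : ℝ → ℝ) (T : ℕ → ℝ → ℝ) (k : ℕ) (t x : ℝ) : ℝ :=
  -(Fk p q T k t x) / (q' t * prodPi q T (k - 1) x)

/-- Solutions of `u' = v x u` starting in `(0, b]` stay there if `v` points inwards at both ends. -/
lemma mem_Ioc_of_inward_field {v : ℝ → ℝ → ℝ} {a b : ℝ} {u : ℝ → ℝ}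
    (hv0 : ∀ x, a ≤ x → 0 < v x 0) (hvb : ∀ x, a ≤ x → v x b < 0)
    (hu : ∀ x ∈ Ici a, HasDerivWithinAt u (v x (u x)) (Ici a) x)
    (hua : 0 < u a) (hub : u a ≤ b) : ∀ x ∈ Ici a, u x ∈ Ioc 0 b := by
  have hc : ContinuousOn u (Ici a) := fun x hx => (hu x hx).continuousWithinAt
  have hr : ∀ x, a ≤ x → HasDerivWithinAt u (v x (u x)) (Ici x) x := fun x hx =>
    (hu x hx).mono (Ici_subset_Ici.2 hx)
  have hle : ∀ x ∈ Ici a, u x ≤ b := fun x hx =>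
    image_le_of_deriv_right_lt_deriv_boundary (B := fun _ => b) (B' := fun _ => 0)
      (hc.mono Icc_subset_Ici_self) (fun t ht => hr t ht.1) hub
      (fun t => hasDerivAt_const t b)
      (fun t ht h => by simpa only [h] using hvb t ht.1) (right_mem_Icc.2 hx)
  have hnn : ∀ x ∈ Ici a, 0 ≤ u x := fun x hx => by
    have := image_le_of_deriv_right_lt_deriv_boundary (f := fun t => -u t)
      (B := fun _ => 0) (B' := fun _ => 0)
      (hc.mono Icc_subset_Ici_self).neg (fun t ht => (hr t ht.1).fun_neg) (by linarith)
      (fun t => hasDerivAt_const t 0)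
      (fun t ht h => by
        rw [neg_eq_zero.1 h]
        linarith [hv0 t ht.1]) (right_mem_Icc.2 hx)
    linarith
  intro x hx
  refine ⟨(hnn x hx).lt_of_ne fun h0 => ?_, hle x hx⟩
  rcases eq_or_lt_of_le (show a ≤ x from hx) with rfl | hax
  · exact hua.ne h0
  · have hmin : IsLocalMin u x := by
      filter_upwards [Ici_mem_nhds hax] with t ht
      exact h0 ▸ hnn t ht
    have hd := hmin.hasDerivAt_eq_zero ((hu x hx).hasDerivAt (Ici_mem_nhds hax))
    rw [← h0] at hd
    exact (hv0 x hx).ne' hd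

/-- If `v` is strictly decreasing and locally Lipschitz in the state variable and points inwards at
both ends of `[0, b]`, then the difference of two ordered solutions is strictly decreasing. -/
lemma strictAntiOn_sub_of_strictAntiOn_field {v : ℝ → ℝ → ℝ} {a b : ℝ} {y z : ℝ → ℝ}
    (hv0 : ∀ x, a ≤ x → 0 < v x 0) (hvb : ∀ x, a ≤ x → v x b < 0)
    (hanti : ∀ x, a ≤ x → StrictAntiOn (v x) (Icc 0 b))
    (hlip : ∀ δ, 0 < δ → ∃ K, ∀ x, a ≤ x → LipschitzOnWith K (v x) (Icc δ b))
    (hy : ∀ x ∈ Ici a, HasDerivWithinAt y (v x (y x)) (Ici a) x)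
    (hz : ∀ x ∈ Ici a, HasDerivWithinAt z (v x (z x)) (Ici a) x)
    (hza : 0 < z a) (hzy : z a < y a) (hya : y a ≤ b) :
    StrictAntiOn (fun x => y x - z x) (Ici a) := by
  have hyc : ContinuousOn y (Ici a) := fun x hx => (hy x hx).continuousWithinAt
  have hzc : ContinuousOn z (Ici a) := fun x hx => (hz x hx).continuousWithinAt
  have hym := mem_Ioc_of_inward_field hv0 hvb hy (hza.trans hzy) hya
  have hzm := mem_Ioc_of_inward_field hv0 hvb hz hza (hzy.le.trans hya)
  have hlt : ∀ x ∈ Ici a, z x < y x := by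
    intro x hx
    by_contra! hle
    have hsub : Icc a x ⊆ Ici a := Icc_subset_Ici_self
    obtain ⟨c, hc, hc0⟩ : (0 : ℝ) ∈ (fun t => y t - z t) '' Icc a x :=
      intermediate_value_Icc' hx ((hyc.sub hzc).mono hsub)
        ⟨sub_nonpos.2 hle, (sub_pos.2 hzy).le⟩
    have hsub' : Icc a c ⊆ Ici a := Icc_subset_Ici_self
    have hne : (Icc a c).Nonempty := nonempty_Icc.2 hc.1
    obtain ⟨s, hs, hsmin⟩ := isCompact_Icc.exists_isMinOn hne (hyc.mono hsub')
    obtain ⟨r, hr, hrmin⟩ := isCompact_Icc.exists_isMinOn hne (hzc.mono hsub')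
    obtain ⟨K, hK⟩ := hlip (min (y s) (z r)) (lt_min (hym s (hsub' hs)).1 (hzm r (hsub' hr)).1)
    have hleft : ∀ u : ℝ → ℝ, (∀ x ∈ Ici a, HasDerivWithinAt u (v x (u x)) (Ici a) x) →
        ∀ t ∈ Ioc a c, HasDerivWithinAt u (v t (u t)) (Iic t) t := fun u hu t ht =>
      ((hu t ht.1.le).hasDerivAt (Ici_mem_nhds ht.1)).hasDerivWithinAt
    have heq := ODE_solution_unique_of_mem_Icc_left (v := v)
      (s := fun _ => Icc (min (y s) (z r)) b)
      (fun t ht => hK t ht.1.le) (hyc.mono hsub') (hleft y hy)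
      (fun t ht => ⟨(min_le_left _ _).trans (hsmin (Ioc_subset_Icc_self ht)), (hym t ht.1.le).2⟩)
      (hzc.mono hsub') (hleft z hz)
      (fun t ht => ⟨(min_le_right _ _).trans (hrmin (Ioc_subset_Icc_self ht)), (hzm t ht.1.le).2⟩)
      (sub_eq_zero.1 hc0)
    exact hzy.ne' (heq (left_mem_Icc.2 hc.1))
  refine strictAntiOn_of_hasDerivWithinAt_neg (convex_Ici a) (hyc.sub hzc)
    (f' := fun x => v x (y x) - v x (z x)) ?_ ?_
  · intro x hx
    exact ((hy x (interior_subset hx)).sub (hz x (interior_subset hx))).mono interior_subset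
  · intro x hx
    have hx' : x ∈ Ici a := interior_subset hx
    exact sub_neg.2 (hanti x hx' (Ioc_subset_Icc_self (hzm x hx'))
      (Ioc_subset_Icc_self (hym x hx')) (hlt x hx'))

/-- The logarithm of a positive `C¹` function on `(0, 1)` is Lipschitz on compact subintervals. -/
lemma exists_lipschitzOnWith_log {p p' : ℝ → ℝ}
    (hpd : ∀ t ∈ Ioc (0 : ℝ) 1, HasDerivWithinAt p (p' t) (Ioc 0 1) t)
    (hp'c : ContinuousOn p' (Ioc 0 1)) (hppos : ∀ t ∈ Ico (0 : ℝ) 1, 0 < p t)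
    {δ b : ℝ} (hδ : 0 < δ) (hb : b < 1) :
    ∃ K, LipschitzOnWith K (fun t => Real.log (p t)) (Icc δ b) := by
  have hsub : Icc δ b ⊆ Ioc 0 1 := fun t ht => ⟨hδ.trans_le ht.1, ht.2.trans hb.le⟩
  have hpos : ∀ t ∈ Icc δ b, 0 < p t := fun t ht =>
    hppos t ⟨hδ.le.trans ht.1, ht.2.trans_lt hb⟩
  have hc : ContinuousOn (fun t => p' t / p t) (Icc δ b) :=
    (hp'c.mono hsub).div (fun t ht => ((hpd t (hsub ht)).mono hsub).continuousWithinAt)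
      fun t ht => (hpos t ht).ne'
  obtain ⟨C, hC⟩ := isCompact_Icc.exists_bound_of_continuousOn hc
  refine ⟨C.toNNReal, (convex_Icc δ b).lipschitzOnWith_of_nnnorm_hasDerivWithin_le
    (fun t ht => ((hpd t (hsub ht)).mono hsub).log (hpos t ht).ne') fun t ht => ?_⟩
  rw [← NNReal.coe_le_coe, coe_nnnorm]
  exact (hC t ht).trans (Real.le_coe_toNNReal C)

lemma antitoneOn_log_of_deriv_nonpos {p p' : ℝ → ℝ} (hpc : ContinuousOn p (Icc 0 1))
    (hpd : ∀ t ∈ Ioc (0 : ℝ) 1, HasDerivWithinAt p (p' t) (Ioc 0 1) t)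
    (hppos : ∀ t ∈ Ico (0 : ℝ) 1, 0 < p t) (hp'le : ∀ t ∈ Ioc (0 : ℝ) 1, p' t ≤ 0) :
    AntitoneOn (fun t => Real.log (p t)) (Ico 0 1) := by
  have hd : ∀ t ∈ interior (Icc (0 : ℝ) 1), HasDerivAt p (p' t) t := fun t ht => by
    rw [interior_Icc] at ht
    exact (hpd t ⟨ht.1, ht.2.le⟩).hasDerivAt (Ioc_mem_nhds ht.1 ht.2)
  have hanti : AntitoneOn p (Icc 0 1) :=
    antitoneOn_of_deriv_nonpos (convex_Icc 0 1) hpc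
      (fun t ht => (hd t ht).differentiableAt.differentiableWithinAt)
      fun t ht => by
        rw [(hd t ht).deriv]
        rw [interior_Icc] at ht
        exact hp'le t ⟨ht.1, ht.2.le⟩
  intro s hs t ht hst
  exact Real.log_le_log (hppos t ht)
    (hanti (Ico_subset_Icc_self hs) (Ico_subset_Icc_self ht) hst)

lemma strictAntiOn_Fk {p : ℝ → ℝ} {T : ℕ → ℝ → ℝ} {k : ℕ} {x : ℝ} (hp0 : p 0 = 1)
    (hL : AntitoneOn (fun t => Real.log (p t)) (Ico 0 1))
    (hπ : prodPi (fun t => 1 - t) T (k - 1) x ∈ Ioo 0 1)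
    (hc : Real.log (p (T (k - 1) x)) < 0) :
    StrictAntiOn (fun t => Fk p (fun t => 1 - t) T k t x) (Ico 0 1) := by
  intro s hs t ht hst
  simp only [Fk]
  set π := prodPi (fun t => 1 - t) T (k - 1) x
  have hst' := hL hs ht hst.le
  have h0 := hL (left_mem_Ico.2 one_pos) ht ht.1
  simp only [hp0, Real.log_one] at h0 hst'
  have h1 : 0 ≤ 1 - π * (1 - s) := by nlinarith [hπ.1, hπ.2, hs.1, hs.2]
  have h2 := mul_le_mul_of_nonneg_left hst' h1
  have h3 : 0 ≤ π * (t - s) * -Real.log (p t) :=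
    mul_nonneg (mul_nonneg hπ.1.le (by linarith)) (by linarith)
  have h4 : 0 < (1 - π) * (t - s) * -Real.log (p (T (k - 1) x)) :=
    mul_pos (mul_pos (by linarith [hπ.2]) (by linarith)) (by linarith)
  linarith

lemma lipschitzOnWith_Phik {p : ℝ → ℝ} {T : ℕ → ℝ → ℝ} {k : ℕ} {x M m δ b : ℝ} {K : NNReal}
    (hδ : 0 ≤ δ) (hb : b ≤ 1)
    (hL : LipschitzOnWith K (fun t => Real.log (p t)) (Icc δ b))
    (hM : ∀ t ∈ Icc δ b, |Real.log (p t)| ≤ M) (hMT : |Real.log (p (T (k - 1) x))| ≤ M)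
    (hm : 0 < m) (hmπ : m ≤ prodPi (fun t => 1 - t) T (k - 1) x)
    (hπ : prodPi (fun t => 1 - t) T (k - 1) x ≤ 1) :
    LipschitzOnWith ((K + 2 * M) / m).toNNReal
      (fun t => Phik p (fun t => 1 - t) (fun _ => -1) T k t x) (Icc δ b) := by
  refine LipschitzOnWith.of_dist_le_mul fun s hs t ht => ?_
  have hM0 : 0 ≤ M := (abs_nonneg _).trans hMT
  rw [Real.coe_toNNReal _ (by positivity), Real.dist_eq, Real.dist_eq]
  have hLst := hL.dist_le_mul s hs t ht
  rw [Real.dist_eq, Real.dist_eq] at hLst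
  have hMs := hM t ht
  simp only [Phik, Fk]
  set π := prodPi (fun t => 1 - t) T (k - 1) x
  set c := Real.log (p (T (k - 1) x))
  set A := Real.log (p s)
  set B := Real.log (p t)
  have hπ0 : 0 < π := hm.trans_le hmπ
  have key : -((1 - π * (1 - s)) * A - (1 - π) * (1 - s) * c) / (-1 * π)
      - -((1 - π * (1 - t)) * B - (1 - π) * (1 - t) * c) / (-1 * π)
      = ((1 - π * (1 - s)) * (A - B) + π * (B * (s - t)) + (1 - π) * (c * (s - t))) / π := by
    field_simp
    ring
  rw [key, abs_div, abs_of_pos hπ0, div_mul_eq_mul_div]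
  have hs1 : s ≤ 1 := hs.2.trans hb
  have hs0 : 0 ≤ s := hδ.trans hs.1
  have e1 : |1 - π * (1 - s)| ≤ 1 := by
    rw [abs_le]; constructor <;> nlinarith
  have t1 : |(1 - π * (1 - s)) * (A - B)| ≤ K * |s - t| := by
    rw [abs_mul]
    calc _ ≤ 1 * |A - B| := by gcongr
      _ ≤ _ := by rw [one_mul]; exact hLst
  have t2 : |π * (B * (s - t))| ≤ M * |s - t| := by
    rw [abs_mul, abs_mul, abs_of_pos hπ0]
    calc _ ≤ 1 * (M * |s - t|) := by gcongr
      _ = _ := one_mul _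
  have t3 : |(1 - π) * (c * (s - t))| ≤ M * |s - t| := by
    rw [abs_mul, abs_mul, abs_of_nonneg (sub_nonneg.2 hπ)]
    calc _ ≤ 1 * (M * |s - t|) := by gcongr; linarith
      _ = _ := one_mul _
  have hnum : |(1 - π * (1 - s)) * (A - B) + π * (B * (s - t)) + (1 - π) * (c * (s - t))|
      ≤ (K + 2 * M) * |s - t| := by
    refine (abs_add_three _ _ _).trans ?_
    linarith
  gcongr

/-- Remark 1. Suppose `q t = 1 - t` (so `q' = -1`), and let
`T₁, …, T_{k-1}` be the functions of the solution of the first `k-1` equations of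
(difeq) constructed in Lemma 2.  If `y`, `z` are solutions of the scalar ODE
`u' x = Φ_k (u x) x` on `[a,∞)` (`a > 0`) with initial values
`f_k a ≤ z a < y a ≤ T_{k-1} a` (where `t = f_k x` is the unique root of
`F_k(t,x) = 0` in `(0, T_{k-1} x)`), then `e = y - z` is strictly decreasing on
`[a,∞)`. -/
theorem difference_of_solutions_decreasing
    (p p' : ℝ → ℝ)
    (hpc : ContinuousOn p (Icc 0 1))
    (hpd : ∀ t ∈ Ioc (0 : ℝ) 1, HasDerivWithinAt p (p' t) (Ioc 0 1) t)
    (hp'c : ContinuousOn p' (Ioc 0 1))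
    (hp0 : p 0 = 1) (hp1 : p 1 = 0)
    (hppos : ∀ t ∈ Ico (0 : ℝ) 1, 0 < p t)
    (hp'le : ∀ t ∈ Ioc (0 : ℝ) 1, p' t ≤ 0)
    (k : ℕ) (hk : 2 ≤ k) (T : ℕ → ℝ → ℝ)
    (hTreg : ∀ i, 1 ≤ i → i ≤ k - 1 →
      ContinuousOn (T i) (Ici 0) ∧ ContDiffOn ℝ 1 (T i) (Ioi 0) ∧
      (∀ x, 0 ≤ x → 0 < T i x ∧ T i x ≤ 1) ∧
      (∀ x, 0 < x → deriv (T i) x < 0) ∧ T i 0 = 1)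
    (hTord : ∀ i, 1 ≤ i → i + 1 ≤ k - 1 → ∀ x, 0 < x → T (i + 1) x < T i x)
    (hTode : ∀ i, 1 ≤ i → i ≤ k - 1 → ∀ x, 0 < x →
      deriv (T i) x = difeqRHS p (fun t => 1 - t) (fun _ => -1) T i x)
    (f : ℝ → ℝ)
    (hf : ∀ x, 0 < x → f x ∈ Ioo (0 : ℝ) (T (k - 1) x) ∧
      Fk p (fun t => 1 - t) T k (f x) x = 0 ∧
      ∀ t ∈ Ioo (0 : ℝ) (T (k - 1) x),
        Fk p (fun t => 1 - t) T k t x = 0 → t = f x)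
    (a : ℝ) (ha : 0 < a) (y z : ℝ → ℝ)
    (hy : ∀ x ∈ Ici a, HasDerivWithinAt y
      (Phik p (fun t => 1 - t) (fun _ => -1) T k (y x) x) (Ici a) x)
    (hz : ∀ x ∈ Ici a, HasDerivWithinAt z
      (Phik p (fun t => 1 - t) (fun _ => -1) T k (z x) x) (Ici a) x)
    (hza : f a ≤ z a) (hzy : z a < y a) (hya : y a ≤ T (k - 1) a) :
    StrictAntiOn (fun x => y x - z x) (Ici a) := by
  have hk1 : 1 ≤ k - 1 := by omega
  have hL := antitoneOn_log_of_deriv_nonpos hpc hpd hppos hp'le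
  have hTanti : ∀ i, 1 ≤ i → i ≤ k - 1 → StrictAntiOn (T i) (Ici 0) := fun i h1 h2 =>
    strictAntiOn_of_deriv_neg (convex_Ici 0) (hTreg i h1 h2).1 fun x hx => by
      rw [interior_Ici] at hx
      exact (hTreg i h1 h2).2.2.2.1 x hx
  have hTm : ∀ i, 1 ≤ i → i ≤ k - 1 → ∀ x, 0 < x → T i x ∈ Ioo 0 1 := fun i h1 h2 x hx =>
    ⟨((hTreg i h1 h2).2.2.1 x hx.le).1,
      (hTreg i h1 h2).2.2.2.2 ▸ hTanti i h1 h2 self_mem_Ici hx.le hx⟩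
  have hπpos : ∀ x, 0 < x → 0 < prodPi (fun t => 1 - t) T (k - 1) x := fun x hx =>
    Finset.prod_pos fun i hi => by
      rw [Finset.mem_Icc] at hi
      exact sub_pos.2 (hTm i hi.1 hi.2 x hx).2
  have hπlt : ∀ x, 0 < x → prodPi (fun t => 1 - t) T (k - 1) x < 1 := fun x hx => by
    have hmem : k - 1 ∈ Finset.Icc 1 (k - 1) := Finset.mem_Icc.2 ⟨hk1, le_rfl⟩
    refine lt_of_le_of_lt (b := 1 - T (k - 1) x) ?_
      (by linarith [(hTm (k - 1) hk1 le_rfl x hx).1])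
    rw [prodPi, ← Finset.mul_prod_erase _ _ hmem]
    refine mul_le_of_le_one_right (sub_pos.2 (hTm (k - 1) hk1 le_rfl x hx).2).le
      (Finset.prod_le_one (fun i hi => ?_) fun i hi => ?_) <;>
    · have hi' := Finset.mem_Icc.1 (Finset.mem_of_mem_erase hi)
      have := hTm i hi'.1 hi'.2 x hx
      linarith [this.1, this.2]
  have hπmono : ∀ x, a ≤ x →
      prodPi (fun t => 1 - t) T (k - 1) a ≤ prodPi (fun t => 1 - t) T (k - 1) x := fun x hx =>
    Finset.prod_le_prod
      (fun i hi => by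
        rw [Finset.mem_Icc] at hi
        exact (sub_pos.2 (hTm i hi.1 hi.2 a ha).2).le)
      fun i hi => by
        rw [Finset.mem_Icc] at hi
        exact sub_le_sub_left ((hTanti i hi.1 hi.2).antitoneOn ha.le (ha.le.trans hx) hx) 1
  have hTk := hTm (k - 1) hk1 le_rfl
  have hLnonpos : ∀ t ∈ Ico (0 : ℝ) 1, Real.log (p t) ≤ 0 := fun t ht => by
    simpa [hp0] using hL (left_mem_Ico.2 one_pos) ht ht.1
  have hc : ∀ x, 0 < x → Real.log (p (T (k - 1) x)) < 0 := by
    intro x hx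
    have hTx := hTk x hx
    refine (hLnonpos _ (Ioo_subset_Ico_self hTx)).lt_of_ne fun h0 => ?_
    obtain ⟨hfx, -, huniq⟩ := hf x hx
    have hhalf : f x / 2 ∈ Ioo 0 (T (k - 1) x) :=
      ⟨half_pos hfx.1, (half_lt_self hfx.1).trans hfx.2⟩
    have hmem : f x / 2 ∈ Ico (0 : ℝ) 1 := ⟨hhalf.1.le, hhalf.2.trans hTx.2⟩
    have hz : Real.log (p (f x / 2)) = 0 :=
      (hLnonpos _ hmem).antisymm (h0 ▸ hL hmem (Ioo_subset_Ico_self hTx) hhalf.2.le)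
    have := huniq _ hhalf (by simp [Fk, hz, h0])
    linarith [hfx.1]
  have hFanti : ∀ x, 0 < x →
      StrictAntiOn (fun t => Fk p (fun t => 1 - t) T k t x) (Ico 0 1) := fun x hx =>
    strictAntiOn_Fk hp0 hL ⟨hπpos x hx, hπlt x hx⟩ (hc x hx)
  have hPhi : ∀ t x, Phik p (fun t => 1 - t) (fun _ => -1) T k t x =
      Fk p (fun t => 1 - t) T k t x / prodPi (fun t => 1 - t) T (k - 1) x := fun t x => by
    rw [Phik, neg_one_mul, neg_div_neg_eq]
  have hfmem : ∀ x, 0 < x → f x ∈ Ico (0 : ℝ) 1 := fun x hx =>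
    ⟨(hf x hx).1.1.le, (hf x hx).1.2.trans (hTk x hx).2⟩
  refine strictAntiOn_sub_of_strictAntiOn_field (b := T (k - 1) a)
    (v := fun x t => Phik p (fun t => 1 - t) (fun _ => -1) T k t x)
    ?_ ?_ ?_ ?_ hy hz ((hf a ha).1.1.trans_le hza) hzy hya
  · intro x hx
    have hx0 := ha.trans_le hx
    simp only [hPhi]
    refine div_pos ?_ (hπpos x hx0)
    have := hFanti x hx0 (left_mem_Ico.2 one_pos) (hfmem x hx0) (hf x hx0).1.1
    simpa only [(hf x hx0).2.1] using this
  · intro x hx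
    have hx0 := ha.trans_le hx
    simp only [hPhi]
    refine div_neg_of_neg_of_pos ?_ (hπpos x hx0)
    have := hFanti x hx0 (hfmem x hx0) (Ioo_subset_Ico_self (hTk a ha))
      ((hf x hx0).1.2.trans_le ((hTanti _ hk1 le_rfl).antitoneOn ha.le hx0.le hx))
    simpa only [(hf x hx0).2.1] using this
  · intro x hx s hs t ht hst
    have hx0 := ha.trans_le hx
    simp only [hPhi]
    exact div_lt_div_of_pos_right (hFanti x hx0 ⟨hs.1, hs.2.trans_lt (hTk a ha).2⟩
      ⟨ht.1, ht.2.trans_lt (hTk a ha).2⟩ hst) (hπpos x hx0)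
  · intro δ hδ
    obtain ⟨K, hK⟩ := exists_lipschitzOnWith_log hpd hp'c hppos hδ (hTk a ha).2
    have hbd : ∀ t, 0 ≤ t → t ≤ T (k - 1) a →
        |Real.log (p t)| ≤ -Real.log (p (T (k - 1) a)) := fun t h0 h1 => by
      have ht : t ∈ Ico (0 : ℝ) 1 := ⟨h0, h1.trans_lt (hTk a ha).2⟩
      rw [abs_of_nonpos (hLnonpos t ht)]
      exact neg_le_neg (hL ht (Ioo_subset_Ico_self (hTk a ha)) h1)
    refine ⟨((K + 2 * -Real.log (p (T (k - 1) a))) /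
      prodPi (fun t => 1 - t) T (k - 1) a).toNNReal, fun x hx => ?_⟩
    have hx0 := ha.trans_le hx
    exact lipschitzOnWith_Phik hδ.le (hTk a ha).2.le hK
      (fun t ht => hbd t (hδ.le.trans ht.1) ht.2)
      (hbd _ (hTk x hx0).1.le ((hTanti _ hk1 le_rfl).antitoneOn ha.le hx0.le hx))
      (hπpos a ha) (hπmono x hx) (hπlt x hx0).le
end
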